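/- arXiv:math/0206269 — 7 statements merged into one kernel-verified Lean document; each statement's English description precedes it below -/
import Mathlib

section
/- For all m, m' ∈ ℤ^l with 0 ≤ m_j < kδ_j and 0 ≤ m'_j < kδ_j for each j, one has the orthonormality relation ∫_{[0,1]^l × [0,1]^l} conj(θ_m(η + Ωδξ, Ω)) · θ_{m'}(η + Ωδξ, Ω) · (2k)^{l/2} (det Ω₂)^{1/2} (δ₁⋯δ_l) · exp(−2πk (δξ)·Ω₂(δξ)) dη dξ = 1 if m = m' and 0 otherwise. In particular the theta functions θ_m, for m ∈ ℤ^l/k(δ₁ℤ⊕⋯⊕δ_lℤ), form an orthonormal family for this inner product. -/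
open Complex Filter Matrix MeasureTheory

/-- The general term of the level-`k` theta series with polarization `δ`. -/
noncomputable def thetaTerm (l k : ℕ) (δ : Fin l → ℕ) (Ω : Matrix (Fin l) (Fin l) ℂ)
    (m p : Fin l → ℤ) (z : Fin l → ℂ) : ℂ :=
  Complex.exp (Real.pi * Complex.I / k *
      (∑ i, ∑ j, ((m i : ℂ) + k * δ i * p i) * Ω i j * ((m j : ℂ) + k * δ j * p j)) +
    2 * Real.pi * Complex.I * ∑ j, ((m j : ℂ) + k * δ j * p j) * z j)

/-- The level-`k` theta function `θ_m(z,Ω)`. -/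
noncomputable def theta (l k : ℕ) (δ : Fin l → ℕ) (Ω : Matrix (Fin l) (Fin l) ℂ)
    (m : Fin l → ℤ) (z : Fin l → ℂ) : ℂ :=
  ∑' p : Fin l → ℤ, thetaTerm l k δ Ω m p z

open scoped MatrixOrder in
lemma Matrix.PosDef.exists_eq_transpose_mul_self {ι : Type*} [Fintype ι] [DecidableEq ι]
    {A : Matrix ι ι ℝ} (hA : A.PosDef) : ∃ B : Matrix ι ι ℝ, A = Bᵀ * B ∧ B.det ≠ 0 := by
  obtain ⟨X, hX, -, hXA⟩ := CFC.exists_sqrt_of_isSelfAdjoint_of_quasispectrumRestricts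
    hA.isHermitian (QuasispectrumRestricts.nnreal_of_nonneg hA.posSemidef.nonneg)
  have hXT : Xᵀ = X := by
    have := hX.star_eq
    rwa [star_eq_conjTranspose, conjTranspose_eq_transpose_of_trivial] at this
  refine ⟨X, by rw [hXT, hXA], fun h => hA.det_pos.ne' ?_⟩
  rw [← hXA, det_mul, h, zero_mul]

lemma Matrix.dotProduct_transpose_mul_self_mulVec {ι : Type*} [Fintype ι]
    (B : Matrix ι ι ℝ) (x : ι → ℝ) : x ⬝ᵥ (Bᵀ * B) *ᵥ x = ∑ i, (B *ᵥ x) i ^ 2 := by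
  rw [← mulVec_mulVec, dotProduct_mulVec, vecMul_transpose]
  simp [dotProduct, sq]

lemma Matrix.exists_pos_mul_sum_sq_le {ι : Type*} [Fintype ι] [DecidableEq ι]
    {B : Matrix ι ι ℝ} (hB : B.det ≠ 0) :
    ∃ c > 0, ∀ x : ι → ℝ, c * ∑ i, x i ^ 2 ≤ ∑ i, (B *ᵥ x) i ^ 2 := by
  set K : ℝ := ∑ i, ∑ j, B⁻¹ i j ^ 2
  have hK : 0 ≤ K := by positivity
  have key (x : ι → ℝ) : ∑ i, x i ^ 2 ≤ K * ∑ i, (B *ᵥ x) i ^ 2 := by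
    rw [Finset.sum_mul]
    refine Finset.sum_le_sum fun i _ => ?_
    have hx : x i = ∑ j, B⁻¹ i j * (B *ᵥ x) j := by
      have : B⁻¹ *ᵥ (B *ᵥ x) = x := by
        rw [mulVec_mulVec, nonsing_inv_mul _ (isUnit_iff_ne_zero.2 hB), one_mulVec]
      exact (congrFun this i).symm
    rw [hx]
    exact Finset.sum_mul_sq_le_sq_mul_sq _ _ _
  refine ⟨(K + 1)⁻¹, by positivity, fun x => ?_⟩
  rw [inv_mul_le_iff₀ (by positivity)]
  have : 0 ≤ ∑ i, (B *ᵥ x) i ^ 2 := by positivity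
  linarith [key x]

lemma integrable_exp_neg_mul_sum_sq {ι : Type*} [Fintype ι] {b : ℝ} (hb : 0 < b) :
    Integrable fun x : ι → ℝ => Real.exp (-b * ∑ i, x i ^ 2) := by
  simp_rw [Finset.mul_sum, Real.exp_sum]
  exact Integrable.fintype_prod (f := fun _ x => Real.exp (-b * x ^ 2))
    fun _ => integrable_exp_neg_mul_sq hb

lemma integral_exp_neg_mul_sum_sq {ι : Type*} [Fintype ι] (b : ℝ) :
    ∫ x : ι → ℝ, Real.exp (-b * ∑ i, x i ^ 2) = √(Real.pi / b) ^ Fintype.card ι := by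
  simp_rw [Finset.mul_sum, Real.exp_sum]
  rw [integral_fintype_prod_volume_eq_pow (fun x : ℝ => Real.exp (-b * x ^ 2)), integral_gaussian]

lemma Matrix.measurableEmbedding_mulVec {ι : Type*} [Fintype ι] [DecidableEq ι]
    {B : Matrix ι ι ℝ} (hB : B.det ≠ 0) : MeasurableEmbedding fun x : ι → ℝ => B *ᵥ x := by
  have hdet : IsUnit
      (LinearMap.toMatrix (Pi.basisFun ℝ ι) (Pi.basisFun ℝ ι) (Matrix.toLin' B)).det := by
    simpa [LinearMap.toMatrix_eq_toMatrix'] using hB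
  exact (LinearEquiv.ofIsUnitDet hdet).toContinuousLinearEquiv.toHomeomorph.measurableEmbedding

lemma integrable_exp_neg_mul_sum_mulVec_sq {ι : Type*} [Fintype ι] [DecidableEq ι]
    {B : Matrix ι ι ℝ} (hB : B.det ≠ 0) {b : ℝ} (hb : 0 < b) :
    Integrable fun x : ι → ℝ => Real.exp (-b * ∑ i, (B *ᵥ x) i ^ 2) := by
  have h := integrable_exp_neg_mul_sum_sq (ι := ι) hb
  have hmap := Real.map_matrix_volume_pi_eq_smul_volume_pi hB
  change Measure.map (fun x : ι → ℝ => B *ᵥ x) volume = _ at hmap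
  refine ((measurableEmbedding_mulVec hB).integrable_map_iff
    (g := fun x : ι → ℝ => Real.exp (-b * ∑ i, x i ^ 2))).1 ?_
  rw [hmap]
  exact h.smul_measure ENNReal.ofReal_ne_top

lemma integral_exp_neg_mul_sum_mulVec_sq {ι : Type*} [Fintype ι] [DecidableEq ι]
    {B : Matrix ι ι ℝ} (hB : B.det ≠ 0) (b : ℝ) :
    ∫ x : ι → ℝ, Real.exp (-b * ∑ i, (B *ᵥ x) i ^ 2) =
      |B.det|⁻¹ * √(Real.pi / b) ^ Fintype.card ι := by
  have hmap := Real.map_matrix_volume_pi_eq_smul_volume_pi hB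
  change Measure.map (fun x : ι → ℝ => B *ᵥ x) volume = _ at hmap
  rw [← (measurableEmbedding_mulVec hB).integral_map
    (fun x : ι → ℝ => Real.exp (-b * ∑ i, x i ^ 2)), hmap,
    integral_smul_measure, integral_exp_neg_mul_sum_sq, ENNReal.toReal_ofReal (abs_nonneg _),
    abs_inv, smul_eq_mul]

lemma summable_fin_prod {n : ℕ} {f : Fin n → ℤ → ℝ} (hf : ∀ i, Summable (f i))
    (hf0 : ∀ i p, 0 ≤ f i p) : Summable fun p : Fin n → ℤ => ∏ i, f i (p i) := by
  induction n with
  | zero => exact Summable.of_finite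
  | succ n ih =>
    rw [← (Fin.consEquiv fun _ : Fin (n + 1) => ℤ).summable_iff]
    have := (hf 0).mul_of_nonneg (ih (fun i => hf i.succ) fun i => hf0 i.succ) (hf0 0)
      fun p => Finset.prod_nonneg fun i _ => hf0 _ _
    refine this.congr fun p => ?_
    simp [Fin.prod_univ_succ, Fin.consEquiv]

lemma summable_exp_neg_mul_sum_sq {n : ℕ} {c : ℝ} (hc : 0 < c) :
    Summable fun p : Fin n → ℤ => Real.exp (-c * ∑ i, (p i : ℝ) ^ 2) := by
  have h : Summable fun p : ℤ => Real.exp (-c * (p : ℝ) ^ 2) := by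
    refine (summable_pow_mul_jacobiTheta₂_term_bound 0 (div_pos hc Real.pi_pos) 0).congr
      fun p => ?_
    have := Real.pi_ne_zero
    simp only [pow_zero, one_mul]
    congr 1
    field_simp
    ring
  refine (summable_fin_prod (f := fun _ p => Real.exp (-c * (p : ℝ) ^ 2)) (fun _ => h)
    fun _ _ => Real.exp_nonneg _).congr fun p => ?_
  rw [← Real.exp_sum, Finset.mul_sum]

lemma hasSum_setIntegral_Icc_add_intCast {ι E : Type*} [Fintype ι] [NormedAddCommGroup E]
    [NormedSpace ℝ E] {f : (ι → ℝ) → E} (hf : Integrable f) :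
    HasSum (fun p : ι → ℤ => ∫ x in Set.Icc (0 : ι → ℝ) 1, f fun i => x i + p i)
      (∫ x, f x) := by
  set s : (ι → ℤ) → Set (ι → ℝ) := fun p => {x | ∀ i, ⌊x i⌋ = p i}
  have hs (p : ι → ℤ) : MeasurableSet (s p) := by
    have : s p = ⋂ i, {x | ⌊x i⌋ = p i} := by ext; simp [s]
    rw [this]
    exact MeasurableSet.iInter fun i =>
      measurableSet_eq_fun (Int.measurable_floor.comp (measurable_pi_apply i)) measurable_const
  have hU : ⋃ p, s p = Set.univ :=
    Set.eq_univ_of_forall fun x => Set.mem_iUnion.2 ⟨fun i => ⌊x i⌋, fun _ => rfl⟩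
  have hd : Pairwise (Function.onFun Disjoint s) := by
    intro p q hpq
    refine Set.disjoint_left.2 fun x hp hq => hpq (funext fun i => (hp i).symm.trans (hq i))
  have key := hasSum_integral_iUnion hs hd (f := f) (μ := volume) hf.integrableOn
  rw [hU, setIntegral_univ] at key
  refine key.congr_fun fun p => ?_
  have hmp : MeasurePreserving (fun x : ι → ℝ => x + fun i => (p i : ℝ)) volume volume :=
    measurePreserving_add_right _ _
  rw [← hmp.setIntegral_preimage_emb (MeasurableEquiv.addRight _).measurableEmbedding f (s p)]
  have hpre : (fun x : ι → ℝ => x + fun i => (p i : ℝ)) ⁻¹' s p =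
      Set.univ.pi fun _ => Set.Ico (0 : ℝ) 1 := by
    ext x
    simp [s, Int.floor_eq_iff, add_comm _ (1 : ℝ)]
  rw [hpre]
  refine (setIntegral_congr_set ?_).symm
  have := Measure.univ_pi_Ico_ae_eq_Icc (μ := fun _ : ι => (volume : Measure ℝ)) (f := 0) (g := 1)
  exact this

lemma setIntegral_Icc_exp_two_pi_mul_intCast {ι : Type*} [Fintype ι] [DecidableEq ι] (n : ι → ℤ) :
    ∫ x in Set.Icc (0 : ι → ℝ) 1, cexp (2 * Real.pi * I * ∑ j, (n j : ℂ) * x j) =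
      if n = 0 then 1 else 0 := by
  have h1 (n : ℤ) : ∫ x in Set.Icc (0 : ℝ) 1, cexp (2 * Real.pi * I * (n * x)) =
      if n = 0 then 1 else 0 := by
    split_ifs with h
    · simp [h]
    · rw [integral_Icc_eq_integral_Ioc, ← intervalIntegral.integral_of_le zero_le_one]
      have hc : (2 * Real.pi * I * n : ℂ) ≠ 0 := by
        simp [Real.pi_ne_zero, h]
      simp_rw [← mul_assoc]
      rw [integral_exp_mul_complex hc]
      have : cexp (2 * Real.pi * I * n) = 1 := by
        rw [mul_comm]; exact Complex.exp_int_mul_two_pi_mul_I n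
      simp [this]
  have hI : Set.Icc (0 : ι → ℝ) 1 = Set.univ.pi fun _ => Set.Icc (0 : ℝ) 1 := by
    rw [Set.pi_univ_Icc]; rfl
  simp_rw [Finset.mul_sum, Complex.exp_sum]
  rw [hI, volume_pi, Measure.restrict_pi_pi,
    integral_fintype_prod_eq_prod (fun j (x : ℝ) => cexp (2 * Real.pi * I * (n j * x)))]
  simp_rw [h1]
  rw [Finset.prod_ite_zero]
  simp [funext_iff]

/-- The real vector `m + kδ(p + ξ)`. -/
def thetaShift {l : ℕ} (k : ℕ) (δ : Fin l → ℕ) (m p : Fin l → ℤ) (ξ : Fin l → ℝ) : Fin l → ℝ :=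
  fun j => m j + k * δ j * (p j + ξ j)

/-- The phase of a theta term at `z = Ωδξ`. -/
noncomputable def thetaPhase {l : ℕ} (k : ℕ) (δ : Fin l → ℕ) (Ω : Matrix (Fin l) (Fin l) ℂ)
    (m p : Fin l → ℤ) (ξ : Fin l → ℝ) : ℝ :=
  Real.pi / k * ((fun j => (m j + k * δ j * p j : ℝ)) ⬝ᵥ
      Ω.map re *ᵥ fun j => (m j + k * δ j * p j : ℝ)) +
    2 * Real.pi * ((fun j => (m j + k * δ j * p j : ℝ)) ⬝ᵥ Ω.map re *ᵥ fun j => δ j * ξ j)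

lemma thetaTerm_eq {l k : ℕ} (hk : k ≠ 0) (δ : Fin l → ℕ) {Ω : Matrix (Fin l) (Fin l) ℂ}
    (hsym : Ωᵀ = Ω) (m p : Fin l → ℤ) (η ξ : Fin l → ℝ) :
    thetaTerm l k δ Ω m p (fun i => (η i : ℂ) + ∑ j, Ω i j * (δ j : ℂ) * (ξ j : ℂ)) =
      Real.exp (-(Real.pi / k) * (thetaShift k δ m p ξ ⬝ᵥ Ω.map im *ᵥ thetaShift k δ m p ξ) +
          Real.pi * k * ((fun j => δ j * ξ j) ⬝ᵥ Ω.map im *ᵥ fun j => δ j * ξ j)) *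
        cexp (2 * Real.pi * I * ∑ j, ((m j + k * δ j * p j : ℤ) : ℂ) * η j) *
        cexp (I * thetaPhase k δ Ω m p ξ) := by
  set n : Fin l → ℝ := fun j => m j + k * δ j * p j with hn
  set y : Fin l → ℝ := fun j => δ j * ξ j with hy
  set A := Ω.map im
  set R := Ω.map re
  have hkC : (k : ℂ) ≠ 0 := by exact_mod_cast hk
  have hΩ (i j) : Ω i j = R i j + A i j * I := (re_add_im _).symm
  have hA : y ⬝ᵥ A *ᵥ n = n ⬝ᵥ A *ᵥ y := by
    have hAT : Aᵀ = A := by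
      change Ωᵀ.map im = Ω.map im
      rw [hsym]
    rw [dotProduct_mulVec, ← mulVec_transpose, hAT, dotProduct_comm]
  have hshift : thetaShift k δ m p ξ = n + (k : ℝ) • y := by
    ext j; simp [thetaShift, n, y]; ring
  have hQ : (n + (k : ℝ) • y) ⬝ᵥ A *ᵥ (n + (k : ℝ) • y) =
      n ⬝ᵥ A *ᵥ n + 2 * k * (n ⬝ᵥ A *ᵥ y) + k ^ 2 * (y ⬝ᵥ A *ᵥ y) := by
    simp only [mulVec_add, mulVec_smul, dotProduct_add, add_dotProduct, smul_dotProduct,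
      dotProduct_smul, smul_eq_mul, hA]
    ring
  have h1 : ∑ i, ∑ j, ((m i : ℂ) + k * δ i * p i) * Ω i j * ((m j : ℂ) + k * δ j * p j) =
      (n ⬝ᵥ R *ᵥ n : ℝ) + (n ⬝ᵥ A *ᵥ n : ℝ) * I := by
    simp only [dotProduct, mulVec, hn]
    push_cast
    simp only [Finset.mul_sum, Finset.sum_mul, ← Finset.sum_add_distrib, hΩ]
    refine Finset.sum_congr rfl fun i _ => Finset.sum_congr rfl fun j _ => ?_
    ring
  have h2 : ∑ j, ((m j : ℂ) + k * δ j * p j) *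
        ((η j : ℂ) + ∑ i, Ω j i * (δ i : ℂ) * (ξ i : ℂ)) =
      ∑ j, ((m j + k * δ j * p j : ℤ) : ℂ) * η j +
        ((n ⬝ᵥ R *ᵥ y : ℝ) + (n ⬝ᵥ A *ᵥ y : ℝ) * I) := by
    simp only [dotProduct, mulVec, hn, hy]
    push_cast
    simp only [mul_add, Finset.mul_sum, Finset.sum_mul, ← Finset.sum_add_distrib, hΩ]
    refine Finset.sum_congr rfl fun i _ => ?_
    congr 1
    refine Finset.sum_congr rfl fun j _ => ?_
    ring
  rw [thetaTerm, h1, h2, hshift, hQ, Complex.ofReal_exp, ← Complex.exp_add, ← Complex.exp_add,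
    thetaPhase]
  congr 1
  push_cast
  field_simp
  linear_combination ((n ⬝ᵥ A *ᵥ n : ℝ) + 2 * k * (n ⬝ᵥ A *ᵥ y : ℝ)) * I_sq

lemma exists_summable_bound_thetaShift {l k : ℕ} (hk : k ≠ 0) {δ : Fin l → ℕ} (hδ : ∀ j, 0 < δ j)
    {A : Matrix (Fin l) (Fin l) ℝ} (hA : A.PosDef) (m : Fin l → ℤ) :
    ∃ b : (Fin l → ℤ) → ℝ, Summable b ∧ (∀ p, 0 ≤ b p) ∧ ∀ p, ∀ ξ ∈ Set.Icc (0 : Fin l → ℝ) 1,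
      Real.exp (-(Real.pi / k) * (thetaShift k δ m p ξ ⬝ᵥ A *ᵥ thetaShift k δ m p ξ)) ≤ b p := by
  obtain ⟨B, rfl, hB⟩ := hA.exists_eq_transpose_mul_self
  obtain ⟨c, hc, hcB⟩ := exists_pos_mul_sum_sq_le hB
  have hk0 : (0 : ℝ) < k := by positivity
  set t : ℝ := Real.pi / k * c
  have ht : 0 < t := by positivity
  set S : ℝ := ∑ j, (|(m j : ℝ)| + k * δ j) ^ 2 with hS
  refine ⟨fun p => Real.exp (t * S) * Real.exp (-(t / 2) * ∑ i, (p i : ℝ) ^ 2),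
    (summable_exp_neg_mul_sum_sq (by positivity)).mul_left _, fun p => by positivity,
    fun p ξ hξ => ?_⟩
  dsimp only
  rw [← Real.exp_add, dotProduct_transpose_mul_self_mulVec]
  refine Real.exp_le_exp.2 ?_
  have h1 := hcB (thetaShift k δ m p ξ)
  have h2 : (∑ i, (p i : ℝ) ^ 2) / 2 - S ≤ ∑ i, thetaShift k δ m p ξ i ^ 2 := by
    rw [hS, Finset.sum_div, ← Finset.sum_sub_distrib]
    refine Finset.sum_le_sum fun i _ => ?_
    have hξ0 : 0 ≤ ξ i := hξ.1 i
    have hξ1 : ξ i ≤ 1 := hξ.2 i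
    have hkδ : (1 : ℝ) ≤ k * δ i := by
      exact_mod_cast Nat.mul_pos (Nat.pos_of_ne_zero hk) (hδ i)
    set a : ℝ := k * δ i
    have hr : (m i + a * ξ i) ^ 2 ≤ (|(m i : ℝ)| + a) ^ 2 := by
      refine sq_le_sq.2 ((abs_add_le _ _).trans ?_)
      rw [abs_of_nonneg (show 0 ≤ |(m i : ℝ)| + a by positivity),
        abs_of_nonneg (show 0 ≤ a * ξ i by positivity)]
      gcongr
      nlinarith
    have hp : (p i : ℝ) ^ 2 ≤ (a * p i) ^ 2 := by
      rw [mul_pow]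
      exact le_mul_of_one_le_left (sq_nonneg _) (one_le_pow₀ hkδ)
    have he : thetaShift k δ m p ξ i = (m i + a * ξ i) + a * p i := by
      simp only [thetaShift, a]; ring
    rw [he]
    nlinarith [sq_nonneg (2 * (m i + a * ξ i) + a * p i)]
  have h3 := mul_le_mul_of_nonneg_left h2 hc.le
  have h4 := mul_le_mul_of_nonneg_left (h3.trans h1) (show 0 ≤ Real.pi / k by positivity)
  simp only [t]
  linarith

lemma hasSum_setIntegral_exp_thetaShift {l k : ℕ} (hk : k ≠ 0) {δ : Fin l → ℕ} (hδ : ∀ j, 0 < δ j)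
    {A : Matrix (Fin l) (Fin l) ℝ} (hA : A.PosDef) (m : Fin l → ℤ) :
    HasSum (fun p : Fin l → ℤ => ∫ ξ in Set.Icc (0 : Fin l → ℝ) 1,
      Real.exp (-(2 * Real.pi / k) * (thetaShift k δ m p ξ ⬝ᵥ A *ᵥ thetaShift k δ m p ξ)))
      ((2 * k : ℝ) ^ ((l : ℝ) / 2) * √A.det * ∏ j, (δ j : ℝ))⁻¹ := by
  obtain ⟨B, rfl, hB⟩ := hA.exists_eq_transpose_mul_self
  have hk0 : (0 : ℝ) < k := by positivity
  have hδ0 (j) : (0 : ℝ) < δ j := by exact_mod_cast hδ j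
  set M := B * Matrix.diagonal fun j => (k : ℝ) * δ j
  have hdet : M.det = B.det * (k ^ l * ∏ j, (δ j : ℝ)) := by
    simp [M, Finset.prod_mul_distrib]
  have hM : M.det ≠ 0 := by
    rw [hdet]
    exact mul_ne_zero hB (mul_pos (pow_pos hk0 _) (Finset.prod_pos fun j _ => hδ0 j)).ne'
  have hb : 0 < 2 * Real.pi / k := by positivity
  set v : Fin l → ℝ := fun j => m j / (k * δ j)
  have hi := (integrable_exp_neg_mul_sum_mulVec_sq hM hb).comp_add_right v
  have key := hasSum_setIntegral_Icc_add_intCast hi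
  rw [integral_add_right_eq_self (fun x => Real.exp (-(2 * Real.pi / k) * ∑ i, (M *ᵥ x) i ^ 2)),
    integral_exp_neg_mul_sum_mulVec_sq hM] at key
  have hval : |M.det|⁻¹ * √(Real.pi / (2 * Real.pi / k)) ^ Fintype.card (Fin l) =
      ((2 * k : ℝ) ^ ((l : ℝ) / 2) * √(Bᵀ * B).det * ∏ j, (δ j : ℝ))⁻¹ := by
    have h2 : (2 * k : ℝ) ^ ((l : ℝ) / 2) = √(2 * k) ^ l := by
      rw [Real.sqrt_eq_rpow, ← Real.rpow_natCast, ← Real.rpow_mul (by positivity)]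
      congr 1
      ring
    have h3 : √(Real.pi / (2 * Real.pi / k)) = k / √(2 * k) := by
      rw [eq_div_iff (by positivity), ← Real.sqrt_mul (by positivity),
        show Real.pi / (2 * Real.pi / k) * (2 * k) = (k : ℝ) ^ 2 by field_simp]
      exact Real.sqrt_sq hk0.le
    have h4 : 0 < ∏ j, (δ j : ℝ) := Finset.prod_pos fun j _ => hδ0 j
    have h5 : 0 < |B.det| := abs_pos.2 hB
    rw [h2, h3, hdet, det_mul, det_transpose, Real.sqrt_mul_self_eq_abs, Fintype.card_fin, abs_mul,
      abs_of_pos (show 0 < (k : ℝ) ^ l * ∏ j, (δ j : ℝ) by positivity), div_pow]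
    field_simp
  rw [hval] at key
  refine key.congr_fun fun p => ?_
  congr 1
  ext ξ
  have hshift : thetaShift k δ m p ξ =
      (Matrix.diagonal fun j => (k : ℝ) * δ j) *ᵥ ((fun i => ξ i + p i) + v) := by
    ext j
    have := (hδ0 j).ne'
    simp only [thetaShift, mulVec_diagonal, Pi.add_apply, v]
    field_simp
    ring
  rw [dotProduct_transpose_mul_self_mulVec, hshift, mulVec_mulVec]

lemma eq_and_eq_of_add_mul_eq {l k : ℕ} {δ : Fin l → ℕ} (hδ : ∀ j, 0 < (k * δ j : ℤ))
    {m m' : Fin l → ℤ} (hm : ∀ j, 0 ≤ m j ∧ m j < k * δ j)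
    (hm' : ∀ j, 0 ≤ m' j ∧ m' j < k * δ j) {p p' : Fin l → ℤ}
    (h : ∀ j, m' j + k * δ j * p' j = m j + k * δ j * p j) : m = m' ∧ p = p' := by
  have hmm : m = m' := by
    ext j
    have := congrArg (· % (k * δ j : ℤ)) (h j)
    simp only [Int.add_mul_emod_self_left] at this
    rw [Int.emod_eq_of_lt (hm' j).1 (hm' j).2, Int.emod_eq_of_lt (hm j).1 (hm j).2] at this
    exact this.symm
  subst hmm
  refine ⟨rfl, funext fun j => ?_⟩
  exact (mul_left_cancel₀ (hδ j).ne' (add_left_cancel (h j))).symm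


lemma continuous_thetaShift {l : ℕ} (k : ℕ) (δ : Fin l → ℕ) (m p : Fin l → ℤ) :
    Continuous (thetaShift k δ m p) := by
  unfold thetaShift
  fun_prop

lemma continuous_thetaPhase {l : ℕ} (k : ℕ) (δ : Fin l → ℕ) (Ω : Matrix (Fin l) (Fin l) ℂ)
    (m p : Fin l → ℤ) : Continuous (thetaPhase k δ Ω m p) := by
  unfold thetaPhase
  fun_prop

/-- The factor depending only on `ξ` of the product of a conjugated theta term and a theta term
with the heat kernel weight. -/
noncomputable def thetaPairWeight {l : ℕ} (k : ℕ) (δ : Fin l → ℕ) (Ω : Matrix (Fin l) (Fin l) ℂ)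
    (m m' p p' : Fin l → ℤ) (ξ : Fin l → ℝ) : ℂ :=
  ((Real.exp (-(Real.pi / k) * (thetaShift k δ m p ξ ⬝ᵥ Ω.map im *ᵥ thetaShift k δ m p ξ)) *
    Real.exp (-(Real.pi / k) * (thetaShift k δ m' p' ξ ⬝ᵥ Ω.map im *ᵥ thetaShift k δ m' p' ξ)) :
      ℝ) : ℂ) * cexp (I * (thetaPhase k δ Ω m' p' ξ - thetaPhase k δ Ω m p ξ : ℝ))

lemma continuous_thetaPairWeight {l : ℕ} (k : ℕ) (δ : Fin l → ℕ) (Ω : Matrix (Fin l) (Fin l) ℂ)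
    (m m' p p' : Fin l → ℤ) : Continuous (thetaPairWeight k δ Ω m m' p p') := by
  have h1 := continuous_thetaShift k δ m p
  have h2 := continuous_thetaShift k δ m' p'
  have h3 := continuous_thetaPhase k δ Ω m p
  have h4 := continuous_thetaPhase k δ Ω m' p'
  unfold thetaPairWeight
  fun_prop

lemma norm_thetaPairWeight {l : ℕ} (k : ℕ) (δ : Fin l → ℕ) (Ω : Matrix (Fin l) (Fin l) ℂ)
    (m m' p p' : Fin l → ℤ) (ξ : Fin l → ℝ) : ‖thetaPairWeight k δ Ω m m' p p' ξ‖ =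
      Real.exp (-(Real.pi / k) * (thetaShift k δ m p ξ ⬝ᵥ Ω.map im *ᵥ thetaShift k δ m p ξ)) *
      Real.exp (-(Real.pi / k) *
        (thetaShift k δ m' p' ξ ⬝ᵥ Ω.map im *ᵥ thetaShift k δ m' p' ξ)) := by
  rw [thetaPairWeight, norm_mul, mul_comm I, Complex.norm_exp_ofReal_mul_I, mul_one,
    Complex.norm_real, Real.norm_of_nonneg (by positivity)]

lemma thetaPairWeight_self {l : ℕ} (k : ℕ) (δ : Fin l → ℕ) (Ω : Matrix (Fin l) (Fin l) ℂ)
    (m p : Fin l → ℤ) (ξ : Fin l → ℝ) : thetaPairWeight k δ Ω m m p p ξ =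
      (Real.exp (-(2 * Real.pi / k) *
        (thetaShift k δ m p ξ ⬝ᵥ Ω.map im *ᵥ thetaShift k δ m p ξ)) : ℝ) := by
  rw [thetaPairWeight, ← Real.exp_add, sub_self, ofReal_zero, mul_zero, Complex.exp_zero, mul_one]
  congr 2
  ring

lemma norm_exp_two_pi_mul_sum_intCast {ι : Type*} [Fintype ι] (n : ι → ℤ) (x : ι → ℝ) :
    ‖cexp (2 * Real.pi * I * ∑ j, (n j : ℂ) * x j)‖ = 1 := by
  rw [show 2 * Real.pi * I * ∑ j, (n j : ℂ) * x j =
    ((2 * Real.pi * ∑ j, (n j : ℝ) * x j : ℝ) : ℂ) * I by push_cast; ring,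
    Complex.norm_exp_ofReal_mul_I]

lemma conj_thetaTerm_mul_thetaTerm {l k : ℕ} (hk : k ≠ 0) (δ : Fin l → ℕ)
    {Ω : Matrix (Fin l) (Fin l) ℂ} (hsym : Ωᵀ = Ω) (m m' p p' : Fin l → ℤ) (η ξ : Fin l → ℝ) :
    (starRingEnd ℂ) (thetaTerm l k δ Ω m p
        (fun i => (η i : ℂ) + ∑ j, Ω i j * (δ j : ℂ) * (ξ j : ℂ))) *
      thetaTerm l k δ Ω m' p' (fun i => (η i : ℂ) + ∑ j, Ω i j * (δ j : ℂ) * (ξ j : ℂ)) *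
      Real.exp (-2 * Real.pi * k * ((fun j => δ j * ξ j) ⬝ᵥ Ω.map im *ᵥ fun j => δ j * ξ j)) =
    cexp (2 * Real.pi * I *
        ∑ j, (((m' j + k * δ j * p' j) - (m j + k * δ j * p j) : ℤ) : ℂ) * η j) *
      thetaPairWeight k δ Ω m m' p p' ξ := by
  rw [thetaTerm_eq hk δ hsym, thetaTerm_eq hk δ hsym, thetaPairWeight]
  simp only [map_mul, ← Complex.exp_conj, map_sum, conj_ofReal, conj_I, map_ofNat, map_intCast]
  simp only [ofReal_exp, ofReal_mul, ← Complex.exp_add]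
  congr 1
  push_cast
  simp only [sub_mul, Finset.sum_sub_distrib]
  ring

lemma hasSum_theta_integrand {l k : ℕ} (hk : k ≠ 0) {δ : Fin l → ℕ} (hδ : ∀ j, 0 < δ j)
    {Ω : Matrix (Fin l) (Fin l) ℂ} (hsym : Ωᵀ = Ω) (hpos : (Ω.map im).PosDef)
    (m m' : Fin l → ℤ) (η : Fin l → ℝ) {ξ : Fin l → ℝ} (hξ : ξ ∈ Set.Icc (0 : Fin l → ℝ) 1) :
    HasSum (fun p : (Fin l → ℤ) × (Fin l → ℤ) =>
        cexp (2 * Real.pi * I *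
          ∑ j, (((m' j + k * δ j * p.2 j) - (m j + k * δ j * p.1 j) : ℤ) : ℂ) * η j) *
        thetaPairWeight k δ Ω m m' p.1 p.2 ξ)
      ((starRingEnd ℂ) (theta l k δ Ω m
          (fun i => (η i : ℂ) + ∑ j, Ω i j * (δ j : ℂ) * (ξ j : ℂ))) *
        theta l k δ Ω m' (fun i => (η i : ℂ) + ∑ j, Ω i j * (δ j : ℂ) * (ξ j : ℂ)) *
        Real.exp (-2 * Real.pi * k *
          ((fun j => δ j * ξ j) ⬝ᵥ Ω.map im *ᵥ fun j => δ j * ξ j))) := by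
  have hs (m : Fin l → ℤ) : Summable fun p => ‖thetaTerm l k δ Ω m p
      (fun i => (η i : ℂ) + ∑ j, Ω i j * (δ j : ℂ) * (ξ j : ℂ))‖ := by
    obtain ⟨b, hb, -, hle⟩ := exists_summable_bound_thetaShift hk hδ hpos m
    refine Summable.of_nonneg_of_le (fun _ => norm_nonneg _) (fun p => ?_) (hb.mul_right
      (Real.exp (Real.pi * k * ((fun j => δ j * ξ j) ⬝ᵥ Ω.map im *ᵥ fun j => δ j * ξ j))))
    rw [thetaTerm_eq hk δ hsym, norm_mul, norm_mul, norm_exp_two_pi_mul_sum_intCast, mul_comm I,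
      Complex.norm_exp_ofReal_mul_I, mul_one, mul_one, Complex.norm_real,
      Real.norm_of_nonneg (Real.exp_nonneg _), Real.exp_add]
    gcongr
    exact hle p ξ hξ
  have hc : Summable fun p => ‖(starRingEnd ℂ) (thetaTerm l k δ Ω m p
      (fun i => (η i : ℂ) + ∑ j, Ω i j * (δ j : ℂ) * (ξ j : ℂ)))‖ := by
    simpa only [RCLike.norm_conj] using hs m
  have key := ((summable_mul_of_summable_norm hc (hs m')).hasSum).mul_right
    (Real.exp (-2 * Real.pi * k *
      ((fun j => δ j * ξ j) ⬝ᵥ Ω.map im *ᵥ fun j => δ j * ξ j)) : ℂ)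
  rw [← tsum_mul_tsum_of_summable_norm hc (hs m'), ← Complex.conj_tsum] at key
  exact key.congr_fun fun p => (conj_thetaTerm_mul_thetaTerm hk δ hsym m m' p.1 p.2 η ξ).symm

lemma hasSum_setIntegral_theta {l k : ℕ} (hk : k ≠ 0) {δ : Fin l → ℕ} (hδ : ∀ j, 0 < δ j)
    {Ω : Matrix (Fin l) (Fin l) ℂ} (hsym : Ωᵀ = Ω) (hpos : (Ω.map im).PosDef)
    (m m' : Fin l → ℤ) :
    HasSum (fun p : (Fin l → ℤ) × (Fin l → ℤ) =>
        if (∀ j, m' j + k * δ j * p.2 j = m j + k * δ j * p.1 j) then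
          ∫ ξ in Set.Icc (0 : Fin l → ℝ) 1, thetaPairWeight k δ Ω m m' p.1 p.2 ξ else 0)
      (∫ q in (Set.Icc (0 : Fin l → ℝ) 1) ×ˢ (Set.Icc (0 : Fin l → ℝ) 1),
        (starRingEnd ℂ) (theta l k δ Ω m
          (fun i => (q.1 i : ℂ) + ∑ j, Ω i j * (δ j : ℂ) * (q.2 j : ℂ))) *
        theta l k δ Ω m' (fun i => (q.1 i : ℂ) + ∑ j, Ω i j * (δ j : ℂ) * (q.2 j : ℂ)) *
        Real.exp (-2 * Real.pi * k *
          ((fun j => δ j * q.2 j) ⬝ᵥ Ω.map im *ᵥ fun j => δ j * q.2 j))) := by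
  obtain ⟨b, hb, hbnn, hle⟩ := exists_summable_bound_thetaShift hk hδ hpos m
  obtain ⟨b', hb', hbpos, hle'⟩ := exists_summable_bound_thetaShift hk hδ hpos m'
  have hS : MeasurableSet ((Set.Icc (0 : Fin l → ℝ) 1) ×ˢ (Set.Icc (0 : Fin l → ℝ) 1)) :=
    measurableSet_Icc.prod measurableSet_Icc
  have hfin : IsFiniteMeasure (volume.restrict
      ((Set.Icc (0 : Fin l → ℝ) 1) ×ˢ (Set.Icc (0 : Fin l → ℝ) 1))) :=
    isFiniteMeasure_restrict.2 (isCompact_Icc.prod isCompact_Icc).measure_lt_top.ne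
  have key := hasSum_integral_of_dominated_convergence
    (μ := volume.restrict ((Set.Icc (0 : Fin l → ℝ) 1) ×ˢ (Set.Icc (0 : Fin l → ℝ) 1)))
    (F := fun (p : (Fin l → ℤ) × (Fin l → ℤ)) q => cexp (2 * Real.pi * I *
          ∑ j, (((m' j + k * δ j * p.2 j) - (m j + k * δ j * p.1 j) : ℤ) : ℂ) * q.1 j) *
        thetaPairWeight k δ Ω m m' p.1 p.2 q.2)
    (fun p _ => b p.1 * b' p.2) (fun p => ?_) (fun p => ?_) (.of_forall fun _ => ?_)
    (integrable_const _)
    (ae_restrict_of_forall_mem hS fun q hq =>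
      hasSum_theta_integrand hk hδ hsym hpos m m' q.1 hq.2)
  · refine key.congr_fun fun p => ?_
    rw [Measure.volume_eq_prod, setIntegral_prod_mul
      (fun η : Fin l → ℝ => cexp (2 * Real.pi * I *
          ∑ j, (((m' j + k * δ j * p.2 j) - (m j + k * δ j * p.1 j) : ℤ) : ℂ) * η j))
      (thetaPairWeight k δ Ω m m' p.1 p.2), setIntegral_Icc_exp_two_pi_mul_intCast]
    simp only [funext_iff, Pi.zero_apply, sub_eq_zero, ite_mul, one_mul, zero_mul]
  · have := continuous_thetaPairWeight k δ Ω m m' p.1 p.2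
    exact Continuous.aestronglyMeasurable (by fun_prop)
  · refine ae_restrict_of_forall_mem hS fun q hq => ?_
    rw [norm_mul, norm_exp_two_pi_mul_sum_intCast, one_mul, norm_thetaPairWeight]
    exact mul_le_mul (hle _ _ hq.2) (hle' _ _ hq.2) (Real.exp_nonneg _) (hbnn _)
  · exact hb.mul_of_nonneg hb' hbnn hbpos

/-- Orthonormality of the theta functions `θ_m`, `0 ≤ m_j < kδ_j`, with respect to the
averaged heat kernel inner product. -/
theorem statement_4 (l k : ℕ) (hl : 1 ≤ l) (hk : 1 ≤ k) (δ : Fin l → ℕ)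
    (hδpos : ∀ j, 0 < δ j) (hδdvd : ∀ i j : Fin l, i ≤ j → δ i ∣ δ j)
    (Ω : Matrix (Fin l) (Fin l) ℂ) (hsym : Ωᵀ = Ω)
    (hpos : (Ω.map Complex.im).PosDef)
    (m m' : Fin l → ℤ)
    (hm : ∀ j, 0 ≤ m j ∧ m j < k * δ j) (hm' : ∀ j, 0 ≤ m' j ∧ m' j < k * δ j) :
    (∫ q in (Set.Icc (0 : Fin l → ℝ) 1) ×ˢ (Set.Icc (0 : Fin l → ℝ) 1),
      (starRingEnd ℂ) (theta l k δ Ω m (fun i => (q.1 i : ℂ) + ∑ j, Ω i j * (δ j : ℂ) * (q.2 j : ℂ))) *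
        theta l k δ Ω m' (fun i => (q.1 i : ℂ) + ∑ j, Ω i j * (δ j : ℂ) * (q.2 j : ℂ)) *
        ((((2 * k : ℝ) ^ ((l : ℝ) / 2) * Real.sqrt (Ω.map Complex.im).det *
            (∏ j, (δ j : ℝ)) *
            Real.exp (-2 * Real.pi * k *
              ∑ i, ∑ j, ((δ i : ℝ) * q.2 i) * (Ω.map Complex.im) i j * ((δ j : ℝ) * q.2 j)) : ℝ)) : ℂ))
      = if m = m' then 1 else 0 := by
  have hk0 : k ≠ 0 := by omega
  have hkδ (j) : 0 < (k * δ j : ℤ) := by exact_mod_cast Nat.mul_pos hk (hδpos j)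
  set c : ℝ := (2 * k : ℝ) ^ ((l : ℝ) / 2) * √(Ω.map im).det * ∏ j, (δ j : ℝ)
  have hc : c ≠ 0 := by
    have h1 : 0 < √(Ω.map im).det := Real.sqrt_pos.2 hpos.det_pos
    have h2 : 0 < ∏ j, (δ j : ℝ) := Finset.prod_pos fun j _ => by exact_mod_cast hδpos j
    positivity
  have hquad (y : Fin l → ℝ) : ∑ i, ∑ j, (δ i * y i) * (Ω.map im) i j * (δ j * y j) =
      (fun j => δ j * y j) ⬝ᵥ Ω.map im *ᵥ fun j => δ j * y j := by
    simp only [dotProduct, mulVec, Finset.mul_sum, mul_assoc]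
  simp_rw [hquad, Complex.ofReal_mul c, mul_left_comm _ (c : ℂ)]
  rw [integral_const_mul]
  have key := hasSum_setIntegral_theta hk0 hδpos hsym hpos m m'
  split_ifs with h
  · subst h
    have hdiag := Complex.hasSum_ofReal.2 (hasSum_setIntegral_exp_thetaShift hk0 hδpos hpos m)
    have hinj : Function.Injective fun p : Fin l → ℤ => (p, p) := fun p q h => (Prod.ext_iff.1 h).1
    rw [← hinj.hasSum_iff fun p hp => if_neg fun h => hp
      ⟨p.1, Prod.ext rfl (eq_and_eq_of_add_mul_eq hkδ hm hm h).2⟩] at key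
    have hval := key.unique (hdiag.congr_fun fun p => ?_)
    · rw [hval, ofReal_inv, mul_inv_cancel₀ (by exact_mod_cast hc)]
    · simp only [Function.comp_apply, implies_true, if_true, thetaPairWeight_self,
        integral_complex_ofReal]
  · rw [key.unique (hasSum_zero.congr_fun fun p => if_neg fun hp =>
      h (eq_and_eq_of_add_mul_eq hkδ hm hm' hp).1), mul_zero]
end

section
/- Let n ≥ 3, let V = {v ∈ ℂ^n : v₁ + ⋯ + v_n = 0} be the complexified Cartan subalgebra of sl(n,ℂ) (identified with its dual via the inner product for which the roots e_i − e_j have squared length 2), let the Weyl group W = S_n act by permuting coordinates, let Λ_R = {α ∈ ℤ^n : Σα_i = 0} be the root lattice and Λ_W = {λ − (Σλ_i/n)(1,…,1) : λ ∈ ℤ^n} the weight lattice. Let τ ∈ ℂ with Im τ > 0. If x ∈ V satisfies x − w(x) ∈ Λ_W + τΛ_W for every w ∈ W, then x ∈ Λ_W + τΛ_W. (Equivalently, the Weyl-invariant part of Pic⁰ of the abelian variety M = 𝔥/(Λ̌_R ⊕ τΛ̌_R) is trivial for n ≥ 3.) -/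
open Complex

/-- The weight lattice of `sl(n,ℂ)`, realized inside the sum-zero hyperplane of `ℂ^n` as
`{λ − (Σλ_i/n)(1,…,1) : λ ∈ ℤ^n}`. -/
def weightLatticeC (n : ℕ) : Set (Fin n → ℂ) :=
  {v | ∃ lam : Fin n → ℤ, v = fun i => (lam i : ℂ) - (∑ j, (lam j : ℂ)) / n}

/-- Two coordinates of a weight of `sl(n,ℂ)` differ by an integer. -/
theorem exists_int_sub_eq_of_mem_weightLatticeC {n : ℕ} {a : Fin n → ℂ}
    (ha : a ∈ weightLatticeC n) (i k : Fin n) : ∃ m : ℤ, a i - a k = m := by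
  obtain ⟨l, rfl⟩ := ha
  exact ⟨l i - l k, by push_cast; ring⟩

/-- If all coordinate differences of a sum-zero vector lie in `ℤ + τℤ`, the vector lies in
`Λ_W + τΛ_W`. -/
theorem exists_weightLatticeC_add_smul_of_sub {n : ℕ} {τ : ℂ} {x : Fin n → ℂ}
    (hx : ∑ i, x i = 0) (j : Fin n)
    (h : ∀ i, ∃ m p : ℤ, x i - x j = m + τ * p) :
    ∃ a ∈ weightLatticeC n, ∃ b ∈ weightLatticeC n, x = a + τ • b := by
  choose m p hmp using h
  refine ⟨_, ⟨m, rfl⟩, _, ⟨p, rfl⟩, ?_⟩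
  have hn : (n : ℂ) ≠ 0 := by
    have := j.pos
    exact_mod_cast this.ne'
  have hsum : -(n * x j) = ∑ i, (m i : ℂ) + τ * ∑ i, (p i : ℂ) := by
    rw [Finset.mul_sum, ← Finset.sum_add_distrib, ← Finset.sum_congr rfl fun i _ => hmp i,
      Finset.sum_sub_distrib, hx]
    simp
  funext i
  simp only [Pi.add_apply, Pi.smul_apply, smul_eq_mul]
  field_simp
  linear_combination (n : ℂ) * hmp i - hsum

/-- For `n ≥ 3`: if `x` in the Cartan subalgebra of `sl(n,ℂ)` satisfies
`x − w(x) ∈ Λ_W + τΛ_W` for every Weyl group element `w`, then `x ∈ Λ_W + τΛ_W`.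
Equivalently, the Weyl-invariant part of `Pic⁰` of `M = 𝔥/(Λ̌_R ⊕ τΛ̌_R)` is trivial. -/
theorem statement_8 (n : ℕ) (hn : 3 ≤ n) (τ : ℂ) (hτ : 0 < τ.im)
    (x : Fin n → ℂ) (hx : ∑ i, x i = 0)
    (h : ∀ w : Equiv.Perm (Fin n), ∃ a ∈ weightLatticeC n, ∃ b ∈ weightLatticeC n,
      (fun i => x i - x (w i)) = a + τ • b) :
    ∃ a ∈ weightLatticeC n, ∃ b ∈ weightLatticeC n, x = a + τ • b := by
  let j : Fin n := ⟨0, by omega⟩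
  refine exists_weightLatticeC_add_smul_of_sub hx j fun i => ?_
  obtain rfl | hij := eq_or_ne i j
  · exact ⟨0, 0, by simp⟩
  obtain ⟨k, hki, hkj⟩ := Fin.exists_ne_and_ne_of_two_lt i j (by omega)
  obtain ⟨a, ha, b, hb, hab⟩ := h (Equiv.swap i j)
  obtain ⟨m, hm⟩ := exists_int_sub_eq_of_mem_weightLatticeC ha i k
  obtain ⟨p, hp⟩ := exists_int_sub_eq_of_mem_weightLatticeC hb i k
  have hi := congrFun hab i
  have hk := congrFun hab k
  simp only [Equiv.swap_apply_left, Equiv.swap_apply_of_ne_of_ne hki hkj, Pi.add_apply,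
    Pi.smul_apply, smul_eq_mul] at hi hk
  exact ⟨m, p, by linear_combination hi - hk + hm + τ * hp⟩
end

section
/- Let k ≥ 1 and let θ₄⁻ = θ_{1,4} − θ_{3,4}. Then for every f ∈ V⁺_{2k} the pointwise product θ₄⁻ · f belongs to V⁻_{2k+4}, and the linear map V⁺_{2k} → V⁻_{2k+4}, f ↦ θ₄⁻ · f, is an isomorphism of complex vector spaces between the space of even level-2k theta functions and the space of odd level-(2k+4) theta functions. -/
open Complex

/-- The general term of the genus-one level-`k'` theta series. -/
noncomputable def theta1Term (τ : ℂ) (k' : ℕ) (m : ℤ) (p : ℤ) (z : ℂ) : ℂ :=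
  Complex.exp (Real.pi * Complex.I * τ * (((m : ℂ) + (k' : ℂ) * p) ^ 2 / (k' : ℂ)) +
    2 * Real.pi * Complex.I * ((m : ℂ) + (k' : ℂ) * p) * z)

/-- `θ_{m,k'}(z) = Σ_{p∈ℤ} exp(πiτ(m+k'p)²/k' + 2πi(m+k'p)z)`. -/
noncomputable def theta1 (τ : ℂ) (k' : ℕ) (m : ℤ) (z : ℂ) : ℂ :=
  ∑' p : ℤ, theta1Term τ k' m p z

/-- `V_{k'} = span_ℂ{θ_{m,k'} : 0 ≤ m ≤ k'−1}`. -/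
noncomputable def thetaSpan (τ : ℂ) (k' : ℕ) : Submodule ℂ (ℂ → ℂ) :=
  Submodule.span ℂ (Set.range fun m : Fin k' => theta1 τ k' (m : ℤ))

/-- The submodule of even functions `f(−z) = f(z)`. -/
noncomputable def evenSub : Submodule ℂ (ℂ → ℂ) where
  carrier := {f | ∀ z, f (-z) = f z}
  add_mem' := by
    intro a b ha hb z
    simp only [Pi.add_apply, ha z, hb z]
  zero_mem' := fun z => rfl
  smul_mem' := by
    intro c f hf z
    simp only [Pi.smul_apply, hf z]

/-- The submodule of odd functions `f(−z) = −f(z)`. -/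
noncomputable def oddSub : Submodule ℂ (ℂ → ℂ) where
  carrier := {f | ∀ z, f (-z) = -f z}
  add_mem' := by
    intro a b ha hb z
    simp only [Pi.add_apply, ha z, hb z]; ring
  zero_mem' := fun z => by simp
  smul_mem' := by
    intro c f hf z
    simp only [Pi.smul_apply, hf z, smul_eq_mul]; ring

section ThetaFunctions

variable {τ : ℂ}

lemma theta1Term_eq_mul_jacobiTheta₂_term {K : ℕ} (hK : K ≠ 0) (m p : ℤ) (z : ℂ) :
    theta1Term τ K m p z =
      cexp (Real.pi * I * τ * (m ^ 2 / K) + 2 * Real.pi * I * m * z) *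
        jacobiTheta₂_term p (m * τ + K * z) (K * τ) := by
  have hK' : (K : ℂ) ≠ 0 := Nat.cast_ne_zero.mpr hK
  rw [theta1Term, jacobiTheta₂_term, ← Complex.exp_add]
  congr 1
  field_simp
  ring

lemma im_natCast_mul_pos (hτ : 0 < τ.im) {K : ℕ} (hK : K ≠ 0) : 0 < ((K : ℂ) * τ).im := by
  have : (0 : ℝ) < K := Nat.cast_pos.mpr (Nat.pos_of_ne_zero hK)
  simpa using mul_pos this hτ

lemma theta1_eq_mul_jacobiTheta₂ {K : ℕ} (hK : K ≠ 0) (m : ℤ) (z : ℂ) :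
    theta1 τ K m z =
      cexp (Real.pi * I * τ * (m ^ 2 / K) + 2 * Real.pi * I * m * z) *
        jacobiTheta₂ (m * τ + K * z) (K * τ) := by
  simp only [theta1, jacobiTheta₂, theta1Term_eq_mul_jacobiTheta₂_term hK, tsum_mul_left]

lemma summable_theta1Term (hτ : 0 < τ.im) {K : ℕ} (hK : K ≠ 0) (m : ℤ) (z : ℂ) :
    Summable fun p => theta1Term τ K m p z := by
  simp only [theta1Term_eq_mul_jacobiTheta₂_term hK]
  exact ((summable_jacobiTheta₂_term_iff _ _).mpr (im_natCast_mul_pos hτ hK)).mul_left _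

lemma hasSum_theta1Term (hτ : 0 < τ.im) {K : ℕ} (hK : K ≠ 0) (m : ℤ) (z : ℂ) :
    HasSum (fun p => theta1Term τ K m p z) (theta1 τ K m z) :=
  (summable_theta1Term hτ hK m z).hasSum

lemma differentiable_theta1 (hτ : 0 < τ.im) {K : ℕ} (hK : K ≠ 0) (m : ℤ) :
    Differentiable ℂ (theta1 τ K m) := by
  have hJ : Differentiable ℂ fun x => jacobiTheta₂ x (K * τ) := fun x =>
    differentiableAt_jacobiTheta₂_fst x (im_natCast_mul_pos hτ hK)
  rw [show theta1 τ K m = _ from funext (theta1_eq_mul_jacobiTheta₂ hK m)]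
  refine Differentiable.mul (by fun_prop) ?_
  exact hJ.comp (g := fun x => jacobiTheta₂ x (K * τ)) (f := fun z => m * τ + K * z) (by fun_prop)

lemma theta1_add_mul (K : ℕ) (m j : ℤ) : theta1 τ K (m + K * j) = theta1 τ K m := by
  funext z
  rw [theta1, theta1, ← (Equiv.addLeft j).tsum_eq fun p => theta1Term τ K m p z]
  refine tsum_congr fun p => ?_
  simp only [theta1Term, Equiv.coe_addLeft]
  push_cast
  congr 1
  ring

lemma theta1_congr {K : ℕ} {m m' : ℤ} (h : m ≡ m' [ZMOD K]) : theta1 τ K m = theta1 τ K m' := by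
  obtain ⟨j, hj⟩ := h.dvd
  rw [show m' = m + K * j by omega, theta1_add_mul]

lemma theta1_neg (K : ℕ) (m : ℤ) (z : ℂ) : theta1 τ K m (-z) = theta1 τ K (-m) z := by
  rw [theta1, theta1, ← (Equiv.neg ℤ).tsum_eq fun p => theta1Term τ K (-m) p z]
  refine tsum_congr fun p => ?_
  simp only [theta1Term, Equiv.neg_apply]
  push_cast
  congr 1
  ring

lemma theta1_mem_thetaSpan {K : ℕ} (hK : K ≠ 0) (m : ℤ) : theta1 τ K m ∈ thetaSpan τ K := by
  have hK' : (0 : ℤ) < K := by omega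
  have h0 := Int.emod_nonneg m hK'.ne'
  have h1 := Int.emod_lt_of_pos m hK'
  refine Submodule.subset_span ⟨⟨(m % K).toNat, by omega⟩, ?_⟩
  refine theta1_congr ?_
  rw [Int.toNat_of_nonneg h0]
  exact Int.mod_modEq m K

instance finiteDimensional_thetaSpan (K : ℕ) : FiniteDimensional ℂ (thetaSpan τ K) :=
  FiniteDimensional.span_of_finite ℂ (Set.finite_range _)

lemma differentiable_of_mem_thetaSpan (hτ : 0 < τ.im) {K : ℕ} {f : ℂ → ℂ}
    (hf : f ∈ thetaSpan τ K) : Differentiable ℂ f := by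
  induction hf using Submodule.span_induction with
  | mem x hx =>
    obtain ⟨m, rfl⟩ := hx
    exact differentiable_theta1 hτ (by have := m.2; omega) _
  | zero => exact differentiable_const 0
  | add f g _ _ hf hg => exact hf.add hg
  | smul c f _ hf => exact hf.const_smul c

/-- The exponents add up by the identity
`p²/L + q²/M = (p+q)²/(L+M) + (Mp−Lq)²/(LM(L+M))`. -/
lemma theta1Term_mul_theta1Term {L M : ℕ} (hL : L ≠ 0) (hM : M ≠ 0) (a b s u : ℤ) (z : ℂ) :
    theta1Term τ L a s z * theta1Term τ M b (s + u) z =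
      cexp (Real.pi * I * τ * ((M * a - L * b - L * M * u) ^ 2 / (L * M * (L + M)))) *
        theta1Term τ (L + M) (a + b + M * u) s z := by
  have hL' : (L : ℂ) ≠ 0 := Nat.cast_ne_zero.mpr hL
  have hM' : (M : ℂ) ≠ 0 := Nat.cast_ne_zero.mpr hM
  have hLM : (L : ℂ) + M ≠ 0 := by exact_mod_cast (by omega : L + M ≠ 0)
  simp only [theta1Term, ← Complex.exp_add]
  congr 1
  push_cast
  field_simp
  ring

lemma theta1_mul_mem_thetaSpan (hτ : 0 < τ.im) {L M : ℕ} (hL : L ≠ 0) (hM : M ≠ 0) (a b : ℤ) :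
    theta1 τ L a * theta1 τ M b ∈ thetaSpan τ (L + M) := by
  have hLM : L + M ≠ 0 := by omega
  let e : ℤ × ℤ ≃ ℤ × ℤ :=
    (Equiv.prodComm ℤ ℤ).trans (Equiv.prodShear (Equiv.refl ℤ) fun s => Equiv.addLeft s)
  let C : ℤ → ℂ := fun u =>
    cexp (Real.pi * I * τ * ((M * a - L * b - L * M * u) ^ 2 / (L * M * (L + M))))
  have hsum : HasSum (fun u : ℤ => C u • theta1 τ (L + M) (a + b + M * u))
      (theta1 τ L a * theta1 τ M b) := by
    refine Pi.hasSum.mpr fun z => ?_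
    have hS := summable_mul_of_summable_norm (f := fun s => theta1Term τ L a s z)
      (g := fun t => theta1Term τ M b t z) (summable_theta1Term hτ hL a z).norm
      (summable_theta1Term hτ hM b z).norm
    have h := (hasSum_theta1Term hτ hL a z).mul (hasSum_theta1Term hτ hM b z) hS
    have he : HasSum (fun x : ℤ × ℤ => theta1Term τ L a x.2 z * theta1Term τ M b (x.2 + x.1) z)
        (theta1 τ L a z * theta1 τ M b z) := e.hasSum_iff.mpr h
    refine he.prod_fiberwise fun u => ?_
    have h' := (hasSum_theta1Term hτ hLM (a + b + M * u) z).mul_left (C u)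
    simp only [C, ← theta1Term_mul_theta1Term hL hM] at h'
    exact h'
  refine (thetaSpan τ (L + M)).closed_of_finiteDimensional.mem_of_tendsto hsum
    (Filter.Eventually.of_forall fun S => ?_)
  exact Submodule.sum_mem _ fun u _ => Submodule.smul_mem _ _ (theta1_mem_thetaSpan hLM _)

lemma mul_mem_thetaSpan (hτ : 0 < τ.im) {L M : ℕ} {f g : ℂ → ℂ}
    (hf : f ∈ thetaSpan τ L) (hg : g ∈ thetaSpan τ M) : f * g ∈ thetaSpan τ (L + M) := by
  have h : thetaSpan τ L * thetaSpan τ M ≤ thetaSpan τ (L + M) := by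
    rw [thetaSpan, thetaSpan, Submodule.span_mul_span, Submodule.span_le]
    rintro _ ⟨_, ⟨m, rfl⟩, _, ⟨n, rfl⟩, rfl⟩
    have := m.2
    have := n.2
    exact theta1_mul_mem_thetaSpan hτ (by omega) (by omega) _ _
  exact h (Submodule.mul_mem_mul hf hg)

lemma integral_jacobiTheta₂ {T : ℂ} (hT : 0 < T.im) :
    ∫ x in (0 : ℝ)..1, jacobiTheta₂ x T = 1 := by
  have hsum : Summable fun n : ℤ => ‖jacobiTheta₂_term n 0 T‖ :=
    ((summable_jacobiTheta₂_term_iff 0 T).mpr hT).norm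
  have hint := intervalIntegral.hasSum_integral_of_dominated_convergence
    (a := 0) (b := 1) (μ := MeasureTheory.volume)
    (F := fun (n : ℤ) (x : ℝ) => jacobiTheta₂_term n x T) (f := fun x : ℝ => jacobiTheta₂ x T)
    (fun n _ => ‖jacobiTheta₂_term n 0 T‖)
    (fun n => by
      unfold jacobiTheta₂_term
      exact Continuous.aestronglyMeasurable (by fun_prop))
    (fun n => Filter.Eventually.of_forall fun x _ => by
      simp [norm_jacobiTheta₂_term])
    (Filter.Eventually.of_forall fun _ _ => hsum)
    intervalIntegrable_const
    (Filter.Eventually.of_forall fun x _ => hasSum_jacobiTheta₂_term x hT)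
  refine hint.unique ?_
  suffices h : ∀ n : ℤ, ∫ x in (0 : ℝ)..1, jacobiTheta₂_term n x T = if n = 0 then 1 else 0 by
    simpa only [h] using hasSum_ite_eq (0 : ℤ) (1 : ℂ)
  intro n
  split_ifs with hn
  · simp [hn, jacobiTheta₂_term]
  · have hc : 2 * (Real.pi : ℂ) * I * n ≠ 0 :=
      mul_ne_zero two_pi_I_ne_zero (Int.cast_ne_zero.mpr hn)
    have hper : cexp (2 * Real.pi * I * n) = 1 := by
      rw [mul_comm]
      exact exp_int_mul_two_pi_mul_I n
    simp only [jacobiTheta₂_term, Complex.exp_add]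
    rw [intervalIntegral.integral_mul_const, integral_exp_mul_complex hc]
    simp [hper]

lemma theta1_ne_zero (hτ : 0 < τ.im) {K : ℕ} (hK : K ≠ 0) (m : ℤ) : theta1 τ K m ≠ 0 := by
  intro h
  have hK' : (K : ℂ) ≠ 0 := Nat.cast_ne_zero.mpr hK
  have hzero : ∀ w, jacobiTheta₂ w (K * τ) = 0 := fun w => by
    have hw := congrFun h ((w - m * τ) / K)
    rw [theta1_eq_mul_jacobiTheta₂ hK, mul_div_cancel₀ _ hK', add_sub_cancel] at hw
    exact (mul_eq_zero.mp hw).resolve_left (exp_ne_zero _)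
  have := integral_jacobiTheta₂ (im_natCast_mul_pos hτ hK)
  simp [hzero] at this

lemma theta1_add_inv {K : ℕ} (hK : K ≠ 0) (m : ℤ) (z : ℂ) :
    theta1 τ K m (z + (K : ℂ)⁻¹) = cexp (2 * Real.pi * I * (m / K)) * theta1 τ K m z := by
  have hK' : (K : ℂ) ≠ 0 := Nat.cast_ne_zero.mpr hK
  rw [theta1, theta1, ← tsum_mul_left]
  refine tsum_congr fun p => ?_
  rw [theta1Term, theta1Term, ← Complex.exp_add, Complex.exp_eq_exp_iff_exists_int]
  refine ⟨p, ?_⟩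
  field_simp
  ring

/-- The theta functions are eigenvectors of the translation by `1/K` with distinct eigenvalues. -/
lemma linearIndependent_theta1 (hτ : 0 < τ.im) (K : ℕ) :
    LinearIndependent ℂ fun m : Fin K => theta1 τ K (m : ℤ) := by
  rcases eq_or_ne K 0 with rfl | hK
  · exact linearIndependent_empty_type
  have hK' : (K : ℂ) ≠ 0 := Nat.cast_ne_zero.mpr hK
  refine Module.End.eigenvectors_linearIndependent'
    (LinearMap.funLeft ℂ ℂ fun z : ℂ => z + (K : ℂ)⁻¹)
    (fun m : Fin K => cexp (2 * Real.pi * I * (((m : ℕ) : ℤ) / K))) ?_ _ fun m => ?_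
  · intro m n hmn
    obtain ⟨j, hj⟩ := Complex.exp_eq_exp_iff_exists_int.mp hmn
    have hj' : (((m : ℕ) : ℤ) : ℂ) = (n : ℕ) + j * K := by
      have h2 : (2 * (Real.pi : ℂ) * I) * (((m : ℕ) : ℤ) / K) =
          (2 * (Real.pi : ℂ) * I) * (((n : ℕ) : ℤ) / K + j) := by rw [hj]; ring
      have h3 := mul_left_cancel₀ two_pi_I_ne_zero h2
      field_simp at h3
      rw [mul_comm (j : ℂ)]
      exact_mod_cast h3
    have hz : ((m : ℕ) : ℤ) = (n : ℕ) + j * K := by exact_mod_cast hj'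
    have hmod := congrArg (· % (K : ℤ)) hz
    simp only [Int.add_mul_emod_self_right] at hmod
    rw [Int.emod_eq_of_lt (by omega) (by exact_mod_cast m.2),
      Int.emod_eq_of_lt (by omega) (by exact_mod_cast n.2)] at hmod
    exact Fin.ext (by exact_mod_cast hmod)
  · refine ⟨Module.End.mem_eigenspace_iff.mpr ?_, theta1_ne_zero hτ hK _⟩
    funext z
    exact theta1_add_inv hK _ z

lemma finrank_thetaSpan (hτ : 0 < τ.im) (K : ℕ) : Module.finrank ℂ (thetaSpan τ K) = K := by
  rw [thetaSpan, finrank_span_eq_card (linearIndependent_theta1 hτ K), Fintype.card_fin]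

lemma comp_neg_mem_thetaSpan {K : ℕ} {f : ℂ → ℂ} (hf : f ∈ thetaSpan τ K) :
    (fun z => f (-z)) ∈ thetaSpan τ K := by
  induction hf using Submodule.span_induction with
  | mem x hx =>
    obtain ⟨m, rfl⟩ := hx
    simp only [theta1_neg]
    exact theta1_mem_thetaSpan (by have := m.2; omega) _
  | zero => exact Submodule.zero_mem _
  | add f g _ _ hf hg => exact Submodule.add_mem _ hf hg
  | smul c f _ hf => exact Submodule.smul_mem _ c hf

lemma thetaSpan_le_even_sup_odd (K : ℕ) :
    thetaSpan τ K ≤ thetaSpan τ K ⊓ evenSub ⊔ thetaSpan τ K ⊓ oddSub := by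
  intro f hf
  have hf' := comp_neg_mem_thetaSpan hf
  refine Submodule.mem_sup.mpr
    ⟨(2⁻¹ : ℂ) • (f + fun z => f (-z)),
      ⟨Submodule.smul_mem _ _ (Submodule.add_mem _ hf hf'), fun z => ?_⟩,
      (2⁻¹ : ℂ) • (f - fun z => f (-z)),
      ⟨Submodule.smul_mem _ _ (Submodule.sub_mem _ hf hf'), fun z => ?_⟩, ?_⟩
  · simp [add_comm]
  · simp only [Pi.smul_apply, Pi.sub_apply, neg_neg, smul_eq_mul]
    ring
  · funext z
    simp only [Pi.add_apply, Pi.smul_apply, Pi.sub_apply, smul_eq_mul]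
    ring

lemma thetaSpan_inf_oddSub_le (n : ℕ) :
    thetaSpan τ (2 * (n + 1)) ⊓ oddSub ≤ Submodule.span ℂ (Set.range fun i : Fin n =>
      theta1 τ (2 * (n + 1)) (i + 1 : ℕ) - theta1 τ (2 * (n + 1)) (-(i + 1 : ℕ))) := by
  set W := Submodule.span ℂ (Set.range fun i : Fin n =>
    theta1 τ (2 * (n + 1)) (i + 1 : ℕ) - theta1 τ (2 * (n + 1)) (-(i + 1 : ℕ))) with hW
  have hgen : ∀ m : ℕ, 0 < m → m < n + 1 →
      theta1 τ (2 * (n + 1)) m - theta1 τ (2 * (n + 1)) (-m) ∈ W := by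
    intro m h0 h1
    refine Submodule.subset_span ⟨⟨m - 1, by omega⟩, ?_⟩
    simp only [Nat.sub_add_cancel h0]
  have hsub : ∀ f ∈ thetaSpan τ (2 * (n + 1)), (f - fun z => f (-z)) ∈ W := by
    intro f hf
    induction hf using Submodule.span_induction with
    | mem x hx =>
      obtain ⟨m, rfl⟩ := hx
      simp only [theta1_neg]
      change theta1 τ (2 * (n + 1)) m - theta1 τ (2 * (n + 1)) (-m) ∈ W
      obtain ⟨m, hm⟩ := m
      dsimp only
      rcases Nat.eq_zero_or_pos m with rfl | h0
      · simp
      rcases lt_trichotomy m (n + 1) with h | h | h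
      · exact hgen m h0 h
      · rw [theta1_congr (m := (m : ℤ)) (m' := -m)
          (Int.modEq_iff_dvd.mpr ⟨-1, by push_cast; omega⟩), sub_self]
        exact W.zero_mem
      · have h2 := hgen (2 * (n + 1) - m) (by omega) (by omega)
        rw [theta1_congr (m' := -m) (Int.modEq_iff_dvd.mpr ⟨-1, by push_cast [hm.le]; ring⟩),
          theta1_congr (m := -((2 * (n + 1) - m : ℕ) : ℤ)) (m' := m)
            (Int.modEq_iff_dvd.mpr ⟨1, by push_cast [hm.le]; ring⟩), ← neg_sub] at h2
        exact (Submodule.neg_mem_iff _).mp h2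
    | zero => exact (sub_self (0 : ℂ → ℂ)).symm ▸ W.zero_mem
    | add f g _ _ hf hg =>
      convert W.add_mem hf hg using 1
      funext z
      simp only [Pi.add_apply, Pi.sub_apply]
      ring
    | smul c f _ hf =>
      convert W.smul_mem c hf using 1
      funext z
      simp only [Pi.smul_apply, Pi.sub_apply, smul_eq_mul]
      ring
  rintro f ⟨hf, hodd⟩
  convert W.smul_mem (2⁻¹ : ℂ) (hsub f hf) using 1
  funext z
  have hz : f (-z) = -f z := hodd z
  simp only [Pi.smul_apply, Pi.sub_apply, hz, smul_eq_mul]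
  ring

lemma finrank_thetaSpan_inf_oddSub_le (n : ℕ) :
    Module.finrank ℂ ↥(thetaSpan τ (2 * (n + 1)) ⊓ oddSub) ≤ n := by
  have := FiniteDimensional.span_of_finite ℂ (Set.finite_range fun i : Fin n =>
    theta1 τ (2 * (n + 1)) (i + 1 : ℕ) - theta1 τ (2 * (n + 1)) (-(i + 1 : ℕ)))
  calc _ ≤ _ := Submodule.finrank_mono (thetaSpan_inf_oddSub_le n)
    _ ≤ Fintype.card (Fin n) := finrank_range_le_card _
    _ = n := Fintype.card_fin n

lemma le_finrank_thetaSpan_inf_evenSub (hτ : 0 < τ.im) (n : ℕ) :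
    n + 2 ≤ Module.finrank ℂ ↥(thetaSpan τ (2 * (n + 1)) ⊓ evenSub) := by
  have h1 := Submodule.finrank_mono (thetaSpan_le_even_sup_odd (τ := τ) (2 * (n + 1)))
  have h2 := Submodule.finrank_add_le_finrank_add_finrank
    (thetaSpan τ (2 * (n + 1)) ⊓ evenSub) (thetaSpan τ (2 * (n + 1)) ⊓ oddSub)
  have h3 := finrank_thetaSpan_inf_oddSub_le (τ := τ) n
  rw [finrank_thetaSpan hτ] at h1
  omega

lemma theta1_four_sub_mem : theta1 τ 4 1 - theta1 τ 4 3 ∈ thetaSpan τ 4 ⊓ oddSub := by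
  refine ⟨Submodule.sub_mem _ (theta1_mem_thetaSpan four_ne_zero 1)
    (theta1_mem_thetaSpan four_ne_zero 3), fun z => ?_⟩
  rw [Pi.sub_apply, Pi.sub_apply, theta1_neg, theta1_neg,
    theta1_congr (K := 4) (m := -1) (m' := 3) (by decide),
    theta1_congr (K := 4) (m := -3) (m' := 1) (by decide), neg_sub]

lemma theta1_four_sub_ne_zero (hτ : 0 < τ.im) : theta1 τ 4 1 - theta1 τ 4 3 ≠ 0 := by
  intro h
  have h13 : (1 : Fin 4) = 3 := (linearIndependent_theta1 hτ 4).injective (sub_eq_zero.mp h)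
  exact absurd h13 (by decide)

lemma mul_mem_thetaSpan_inf_oddSub (hτ : 0 < τ.im) {L M : ℕ} {f g : ℂ → ℂ}
    (hg : g ∈ thetaSpan τ L ⊓ oddSub) (hf : f ∈ thetaSpan τ M ⊓ evenSub) :
    g * f ∈ thetaSpan τ (M + L) ⊓ oddSub := by
  refine ⟨add_comm L M ▸ mul_mem_thetaSpan hτ hg.1 hf.1, fun z => ?_⟩
  have h1 : g (-z) = -g z := hg.2 z
  have h2 : f (-z) = f z := hf.2 z
  rw [Pi.mul_apply, Pi.mul_apply, h1, h2, neg_mul]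

lemma eq_zero_of_mul_eq_zero_of_differentiable {f g : ℂ → ℂ} (hf : Differentiable ℂ f)
    (hg : Differentiable ℂ g) (hg0 : g ≠ 0) (h : g * f = 0) : f = 0 := by
  rcases AnalyticOnNhd.eq_zero_or_eq_zero_of_smul_eq_zero (U := Set.univ)
    (fun z _ => hg.analyticAt z) (fun z _ => hf.analyticAt z)
    (fun z _ => congrFun h z) isPreconnected_univ with h | h
  · exact absurd (funext fun z => h z trivial) hg0
  · exact funext fun z => h z trivial

end ThetaFunctions

/-- Multiplication by `θ₄⁻ = θ_{1,4} − θ_{3,4}` maps `V⁺_{2k}` into `V⁻_{2k+4}` and defines a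
linear isomorphism `V⁺_{2k} ≃ V⁻_{2k+4}`. -/
theorem statement_14 (τ : ℂ) (hτ : 0 < τ.im) (k : ℕ) (hk : 1 ≤ k) :
    (∀ f ∈ thetaSpan τ (2 * k) ⊓ evenSub,
      (fun z => (theta1 τ 4 1 z - theta1 τ 4 3 z) * f z) ∈
        thetaSpan τ (2 * k + 4) ⊓ oddSub) ∧
    ∃ e : ↥(thetaSpan τ (2 * k) ⊓ evenSub) ≃ₗ[ℂ] ↥(thetaSpan τ (2 * k + 4) ⊓ oddSub),
      ∀ f : ↥(thetaSpan τ (2 * k) ⊓ evenSub),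
        (e f : ℂ → ℂ) = fun z => (theta1 τ 4 1 z - theta1 τ 4 3 z) * (f : ℂ → ℂ) z := by
  have hmem : ∀ f ∈ thetaSpan τ (2 * k) ⊓ evenSub,
      LinearMap.mulLeft ℂ (theta1 τ 4 1 - theta1 τ 4 3) f ∈ thetaSpan τ (2 * k + 4) ⊓ oddSub :=
    fun f hf => mul_mem_thetaSpan_inf_oddSub hτ theta1_four_sub_mem hf
  refine ⟨hmem, ?_⟩
  let φ := (LinearMap.mulLeft ℂ (theta1 τ 4 1 - theta1 τ 4 3)).restrict hmem
  have hinj : Function.Injective φ := by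
    refine (injective_iff_map_eq_zero φ).mpr fun f hf => Subtype.ext ?_
    exact eq_zero_of_mul_eq_zero_of_differentiable (differentiable_of_mem_thetaSpan hτ f.2.1)
      (differentiable_of_mem_thetaSpan hτ theta1_four_sub_mem.1) (theta1_four_sub_ne_zero hτ)
      (congrArg Subtype.val hf)
  have hrank : Module.finrank ℂ ↥(thetaSpan τ (2 * k) ⊓ evenSub) =
      Module.finrank ℂ ↥(thetaSpan τ (2 * k + 4) ⊓ oddSub) := by
    refine le_antisymm (LinearMap.finrank_le_finrank_of_injective hinj) ?_
    obtain ⟨n, rfl⟩ := Nat.exists_eq_add_of_le' hk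
    exact (finrank_thetaSpan_inf_oddSub_le (n + 2)).trans (le_finrank_thetaSpan_inf_evenSub hτ n)
  exact ⟨LinearMap.linearEquivOfInjective φ hinj hrank, fun f => rfl⟩
end

section
/- Let τ ∈ ℂ with Im τ > 0, let a ∈ ℝ with a ∉ ℤ, and let d ∈ ℂ. If F : ℂ → ℂ is holomorphic and satisfies F(z + 1) = F(z) and F(z + τ) = exp(d − 2πi a z) · F(z) for all z ∈ ℂ, then F is identically zero. That is, nonzero holomorphic functions with the periodicity and quasi-periodicity of level-a theta functions exist only when the level a is an integer. -/
open Complex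

/-- A nonzero holomorphic function on `ℂ` with the periodicity `F(z+1) = F(z)` and the
quasi-periodicity `F(z+τ) = exp(d − 2πi a z) F(z)` of a level-`a` theta function can exist
only if the level `a` is an integer: if `a ∉ ℤ`, then `F ≡ 0`. -/
theorem statement_15 (τ : ℂ) (hτ : 0 < τ.im) (a : ℝ) (ha : ∀ n : ℤ, a ≠ (n : ℝ)) (d : ℂ)
    (F : ℂ → ℂ) (hF : Differentiable ℂ F)
    (h1 : ∀ z : ℂ, F (z + 1) = F z)
    (h2 : ∀ z : ℂ, F (z + τ) = Complex.exp (d - 2 * Real.pi * Complex.I * (a : ℂ) * z) * F z) :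
    ∀ z : ℂ, F z = 0 := by
  intro z
  by_contra hz
  have key : F (z + 1 + τ) = F (z + τ) := by rw [add_right_comm, h1]
  rw [h2, h2, h1] at key
  obtain ⟨n, hn⟩ := Complex.exp_eq_exp_iff_exists_int.mp (mul_right_cancel₀ hz key)
  refine ha (-n) (Complex.ofReal_injective ?_)
  apply mul_left_cancel₀ Complex.two_pi_I_ne_zero
  push_cast
  linear_combination -hn
end

section
/- Let n ≥ 3, k ≥ 0, and k' = k + n. Realize the Cartan data of sl(n,ℂ) as: 𝔥_ℝ* = {v ∈ ℝ^n : Σv_i = 0} with the standard inner product ⟨·,·⟩ (so roots e_i − e_j have squared length 2), root lattice Λ_R = {α ∈ ℤ^n : Σα_i = 0}, weight lattice Λ_W = {λ − (Σλ_i/n)(1,…,1) : λ ∈ ℤ^n}, and Weyl group W = S_n permuting coordinates with sign character ε. For τ ∈ ℂ with Im τ > 0 and γ ∈ Λ_W define θ_{γ,k'}(v) = Σ_{α∈Λ_R} exp(πi k' τ ⟨α + γ/k', α + γ/k'⟩ + 2πi k' ⟨α + γ/k', v⟩) for v in the complexification 𝔥 of 𝔥_ℝ. Then the space of Weyl anti-invariant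 elements {f ∈ span_ℂ{θ_{γ,k'} : γ ∈ Λ_W} : f(w(v)) = ε(w)f(v) for all w ∈ W, v ∈ 𝔥} has dimension equal to the Verlinde number binom(n + k − 1, k). -/
open Complex

/-- The level-`k'` theta function `θ_{γ,k'}` for `sl(n,ℂ)`: a sum over the root lattice
`Λ_R = {α ∈ ℤ^n : Σα_i = 0}`, with the standard inner product on the sum-zero hyperplane. -/
noncomputable def thetaSL (n : ℕ) (τ : ℂ) (k' : ℕ) (γ : Fin n → ℂ) (v : Fin n → ℂ) : ℂ :=
  ∑' α : {a : Fin n → ℤ // ∑ i, a i = 0},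
    Complex.exp (Real.pi * Complex.I * (k' : ℂ) * τ *
        (∑ i, ((α.1 i : ℂ) + γ i / (k' : ℂ)) ^ 2) +
      2 * Real.pi * Complex.I * (k' : ℂ) * ∑ i, ((α.1 i : ℂ) + γ i / (k' : ℂ)) * v i)

/-- The submodule of Weyl anti-invariant functions on the (complexified) Cartan subalgebra:
`f(w(v)) = ε(w) f(v)` for all permutations `w`. -/
noncomputable def antiInvSub (n : ℕ) : Submodule ℂ ((Fin n → ℂ) → ℂ) where
  carrier := {f | ∀ (w : Equiv.Perm (Fin n)) (v : Fin n → ℂ),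
    f (fun i => v (w i)) = ((Equiv.Perm.sign w : ℤ) : ℂ) * f v}
  add_mem' := by
    intro a b ha hb w v
    simp only [Pi.add_apply, ha w v, hb w v]; ring
  zero_mem' := by
    intro w v; simp
  smul_mem' := by
    intro c f hf w v
    simp only [Pi.smul_apply, hf w v, smul_eq_mul]; ring

open MeasureTheory in
noncomputable local instance : MeasureSpace UnitAddCircle := ⟨AddCircle.haarAddCircle⟩
open MeasureTheory in
local instance : Measure.IsAddHaarMeasure (volume : Measure UnitAddCircle) :=
  inferInstanceAs (Measure.IsAddHaarMeasure AddCircle.haarAddCircle)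
open MeasureTheory in
local instance : IsProbabilityMeasure (volume : Measure UnitAddCircle) :=
  inferInstanceAs (IsProbabilityMeasure AddCircle.haarAddCircle)

theorem eq_zero_of_tsum_mFourier_eq_zero {d ι : Type*} [Fintype d] {c : ι → ℂ}
    (hc : Summable c) {e : ι → d → ℤ} (he : Function.Injective e)
    (h : ∀ x : UnitAddTorus d, ∑' i, c i * UnitAddTorus.mFourier (e i) x = 0) (j : ι) :
    c j = 0 := by
  have hs : Summable fun i => c i • (UnitAddTorus.mFourier (e i)) := by
    refine Summable.of_norm ?_
    simpa only [norm_smul, UnitAddTorus.mFourier_norm, mul_one] using hc.norm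
  have h0 : ∑' i, c i • (UnitAddTorus.mFourier (e i)) = 0 := by
    ext x
    refine (ContinuousMap.tsum_apply hs x).symm.trans ?_
    simpa using h x
  have h1 := hs.hasSum
  rw [h0] at h1
  have h2 := h1.mapL (ContinuousMap.toLp (E := ℂ) 2 MeasureTheory.volume ℂ)
  have h3 : HasSum (fun i => c i • UnitAddTorus.mFourierLp 2 (e i)) 0 := by
    simpa only [map_smul, map_zero, UnitAddTorus.mFourierLp] using h2
  have h4 := h3.mapL (innerSL ℂ (UnitAddTorus.mFourierLp 2 (e j)))
  have hon := UnitAddTorus.orthonormal_mFourier.comp e he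
  classical
  have h5 := orthonormal_iff_ite.1 hon
  simp only [map_smul, innerSL_apply_apply, map_zero, smul_eq_mul, Function.comp_apply] at h4 h5
  simp only [h5, mul_ite, mul_one, mul_zero] at h4
  have h6 := h4.unique (hasSum_single j fun i hi => if_neg (Ne.symm hi))
  simpa using h6.symm

theorem Summable.prod_fin_of_nonneg {α : Type*} {n : ℕ} {f : Fin n → α → ℝ}
    (hf : ∀ i, Summable (f i)) (h0 : ∀ i a, 0 ≤ f i a) :
    Summable fun x : Fin n → α => ∏ i, f i (x i) := by
  induction n with
  | zero => exact Summable.of_finite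
  | succ n ih =>
    have := (hf 0).mul_of_nonneg (ih (f := fun i => f i.succ) (fun i => hf _) fun i a => h0 _ a)
      (h0 0) (fun x => Finset.prod_nonneg fun i _ => h0 _ _)
    rw [← (Fin.consEquiv fun _ => α).summable_iff]
    simpa [Function.comp_def, Fin.prod_univ_succ] using this

theorem summable_exp_neg_mul_int_add_sq {b : ℝ} (hb : 0 < b) (c : ℝ) :
    Summable fun a : ℤ => Real.exp (-b * (a + c) ^ 2) := by
  have h := ((summable_jacobiTheta₂_term_iff (z := (b * c / Real.pi : ℝ) * I)
    (τ := (b / Real.pi : ℝ) * I)).2 (by simp; positivity)).norm.mul_left (Real.exp (-b * c ^ 2))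
  refine h.congr fun a => ?_
  rw [norm_jacobiTheta₂_term, ← Real.exp_add]
  congr 1
  simp
  field_simp
  ring
/-- The residues of `n λ_j - ∑ λ_i` modulo `n K`: a complete invariant of the weight
`λ - (∑ λ_i / n)(1,…,1)` modulo `K Λ_R`. -/
def weightResidue (n K : ℕ) (l : Fin n → ℤ) : Fin n → ℤ :=
  fun j => (n * l j - ∑ i, l i) % (n * K)

theorem weightResidue_eq_iff {n K : ℕ} {l l' : Fin n → ℤ} :
    weightResidue n K l = weightResidue n K l' ↔
      ∀ j, (n * K : ℤ) ∣ (n * l' j - ∑ i, l' i) - (n * l j - ∑ i, l i) := by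
  simp only [funext_iff, weightResidue]
  exact forall_congr' fun j => Int.modEq_iff_dvd

theorem weightResidue_apply_eq_iff {n K : ℕ} (hn : n ≠ 0) (l : Fin n → ℤ) (i j : Fin n) :
    weightResidue n K l i = weightResidue n K l j ↔ (K : ℤ) ∣ l j - l i := by
  have h : (n * l j - ∑ i, l i) - (n * l i - ∑ i, l i) = (n : ℤ) * (l j - l i) := by ring
  have h2 := Int.modEq_iff_dvd (n := n * K) (a := n * l i - ∑ i, l i) (b := n * l j - ∑ i, l i)
  rw [h, mul_dvd_mul_iff_left (by exact_mod_cast hn)] at h2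
  exact h2

theorem weightResidue_comp_perm {n K : ℕ} (l : Fin n → ℤ) (w : Equiv.Perm (Fin n)) :
    weightResidue n K (l ∘ w) = weightResidue n K l ∘ w := by
  funext j
  simp [weightResidue, Equiv.sum_comp w l]

theorem finite_range_weightResidue {n K : ℕ} (hn : n ≠ 0) (hK : K ≠ 0) :
    (Set.range (weightResidue n K)).Finite := by
  have hpos : (0 : ℤ) < n * K := by positivity
  refine (Set.Finite.pi' (fun _ : Fin n => Set.finite_Ico (0 : ℤ) (n * K))).subset ?_
  rintro _ ⟨l, rfl⟩ j
  exact ⟨Int.emod_nonneg _ hpos.ne', Int.emod_lt_of_pos _ hpos⟩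

/-- The integral weight with coordinates `f`, shifted by `K b` in the zeroth coordinate. -/
def liftWeight {n K : ℕ} [NeZero n] (p : (Fin n ↪ Fin K) × Fin n) : Fin n → ℤ :=
  fun j => (p.1 j : ℤ) + if j = 0 then (K * (p.2 : ℕ) : ℤ) else 0

theorem sum_liftWeight {n K : ℕ} [NeZero n] (p : (Fin n ↪ Fin K) × Fin n) :
    ∑ j, liftWeight p j = ∑ j, (p.1 j : ℤ) + K * (p.2 : ℕ) := by
  simp [liftWeight, Finset.sum_add_distrib]

theorem dvd_liftWeight_sub {n K : ℕ} [NeZero n] (p : (Fin n ↪ Fin K) × Fin n) (j : Fin n) :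
    (K : ℤ) ∣ liftWeight p j - (p.1 j : ℤ) := by
  unfold liftWeight
  split_ifs <;> simp

theorem fin_eq_of_dvd_sub {K : ℕ} {a b : Fin K} (h : (K : ℤ) ∣ (b : ℤ) - a) : a = b := by
  have := Int.modEq_iff_dvd.2 h
  have h2 := Int.natCast_modEq_iff.1 this
  exact Fin.ext (Nat.ModEq.eq_of_lt_of_lt h2 a.2 b.2)

theorem weightResidue_liftWeight_injective {n K : ℕ} [NeZero n]
    (p : (Fin n ↪ Fin K) × Fin n) :
    Function.Injective (weightResidue n K (liftWeight p)) := by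
  intro i j h
  rw [weightResidue_apply_eq_iff (NeZero.ne n)] at h
  refine p.1.injective (fin_eq_of_dvd_sub ?_)
  have := (h.sub (dvd_liftWeight_sub p j)).add (dvd_liftWeight_sub p i)
  simpa using this

/-- The residue classes of weights with trivial stabilizer in the Weyl group. -/
abbrev RegularResidue (n K : ℕ) : Type :=
  {g : Fin n → ℤ // g ∈ Set.range (weightResidue n K) ∧ Function.Injective g}

/-- The residue classes of weights with strictly increasing representative. -/
abbrev DominantResidue (n K : ℕ) : Type :=
  {g : Fin n → ℤ // g ∈ Set.range (weightResidue n K) ∧ StrictMono g}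

theorem liftWeight_bijective {n K : ℕ} [NeZero n] (hK : K ≠ 0) :
    Function.Bijective (fun p : (Fin n ↪ Fin K) × Fin n =>
      ((⟨weightResidue n K (liftWeight p), ⟨_, rfl⟩, weightResidue_liftWeight_injective p⟩, p.1 0) :
        RegularResidue n K × Fin K)) := by
  have hn : n ≠ 0 := NeZero.ne n
  have hn' : (n : ℤ) ≠ 0 := by exact_mod_cast hn
  have hK' : (K : ℤ) ≠ 0 := by exact_mod_cast hK
  constructor
  · intro p q h
    simp only [Prod.mk.injEq, Subtype.mk.injEq] at h
    obtain ⟨h, h0⟩ := h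
    rw [weightResidue_eq_iff] at h
    simp only [sum_liftWeight] at h
    have hsum := h 0
    have hs : (n * K : ℤ) ∣ (∑ j, (q.1 j : ℤ) + K * (q.2 : ℕ)) -
        (∑ j, (p.1 j : ℤ) + K * (p.2 : ℕ)) := by
      have e : (∑ j, (q.1 j : ℤ) + K * (q.2 : ℕ)) - (∑ j, (p.1 j : ℤ) + K * (p.2 : ℕ)) =
          n * K * ((q.2 : ℕ) - (p.2 : ℕ) : ℤ) -
          (n * liftWeight q 0 - (∑ j, (q.1 j : ℤ) + K * (q.2 : ℕ)) -
            (n * liftWeight p 0 - (∑ j, (p.1 j : ℤ) + K * (p.2 : ℕ)))) := by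
        simp only [liftWeight, if_true, h0]; ring
      rw [e]
      exact (dvd_mul_right _ _).sub hsum
    have hf : p.1 = q.1 := by
      ext1 j
      refine fin_eq_of_dvd_sub ?_
      have h1 := (h j).add hs
      rw [show ∀ a b c d : ℤ, n * a - c - (n * b - d) + (c - d) = n * (a - b) by intros; ring,
        mul_dvd_mul_iff_left hn'] at h1
      have := (h1.sub (dvd_liftWeight_sub q j)).add (dvd_liftWeight_sub p j)
      simpa using this
    have hb : p.2 = q.2 := by
      refine fin_eq_of_dvd_sub ?_
      rw [hf, add_sub_add_left_eq_sub, ← mul_sub, mul_comm (n : ℤ), mul_dvd_mul_iff_left hK'] at hs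
      exact hs
    exact Prod.ext hf hb
  · rintro ⟨⟨_, ⟨l, rfl⟩, hl⟩, x⟩
    have hKpos : (0 : ℤ) < K := by positivity
    have hnpos : (0 : ℤ) < n := by positivity
    set f : Fin n → Fin K := fun j =>
      ⟨((x + l j - l 0) % K).toNat, by
        have h1 := Int.emod_nonneg (x + l j - l 0) hK'
        have h2 := Int.emod_lt_of_pos (x + l j - l 0) hKpos
        omega⟩ with hf
    have hfv : ∀ j, (K : ℤ) ∣ (x + l j - l 0) - (f j : ℤ) := by
      intro j
      simp only [hf, Int.toNat_of_nonneg (Int.emod_nonneg (x + l j - l 0) hK')]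
      exact Int.dvd_self_sub_emod
    have hf0 : f 0 = x := fin_eq_of_dvd_sub (by simpa using hfv 0)
    have hinj : Function.Injective f := by
      intro i j hij
      refine hl ((weightResidue_apply_eq_iff hn l i j).2 ?_)
      have := (hfv j).sub (hfv i)
      rw [hij] at this
      simpa using this
    obtain ⟨c, hc⟩ : (K : ℤ) ∣ (n * x + ∑ i, l i - n * l 0) - ∑ j, (f j : ℤ) := by
      have : (n * x + ∑ i, l i - n * l 0) - ∑ j, (f j : ℤ) =
          ∑ j, ((x + l j - l 0) - (f j : ℤ)) := by
        simp [Finset.sum_add_distrib, Finset.sum_sub_distrib]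
      rw [this]
      exact Finset.dvd_sum fun j _ => hfv j
    set b : Fin n := ⟨(c % n).toNat, by
        have h1 := Int.emod_nonneg c hn'
        have h2 := Int.emod_lt_of_pos c hnpos
        omega⟩ with hb
    obtain ⟨d, hd⟩ : (n : ℤ) ∣ c - (b : ℕ) := by
      simp only [hb, Int.toNat_of_nonneg (Int.emod_nonneg c hn')]
      exact Int.dvd_self_sub_emod
    refine ⟨(⟨f, hinj⟩, b), ?_⟩
    refine Prod.ext (Subtype.ext ?_) hf0
    refine weightResidue_eq_iff.2 fun j => ?_
    rw [sum_liftWeight]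
    obtain ⟨e, he⟩ := hfv j
    obtain ⟨e', he'⟩ := dvd_liftWeight_sub (⟨f, hinj⟩, b) j
    simp only [Function.Embedding.coeFn_mk] at he' ⊢
    refine ⟨e - e' - d, ?_⟩
    linear_combination (n : ℤ) * he - n * he' - hc - (K : ℤ) * hd

theorem sort_comp_perm {n : ℕ} {g : Fin n → ℤ} (hg : Function.Injective g)
    (w : Equiv.Perm (Fin n)) : Tuple.sort (g ∘ w) = w⁻¹ * Tuple.sort g := by
  have h := Tuple.comp_perm_comp_sort_eq_comp_sort (f := g) (σ := w)
  ext1 i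
  have := hg (congrFun h i)
  simp [← this]

theorem sort_of_strictMono {n : ℕ} {g : Fin n → ℤ} (hg : StrictMono g) : Tuple.sort g = 1 :=
  Tuple.sort_eq_refl_iff_monotone.2 hg.monotone

theorem comp_mem_range_weightResidue {n K : ℕ} {g : Fin n → ℤ}
    (hg : g ∈ Set.range (weightResidue n K)) (w : Equiv.Perm (Fin n)) :
    g ∘ w ∈ Set.range (weightResidue n K) := by
  obtain ⟨l, rfl⟩ := hg
  exact ⟨l ∘ w, weightResidue_comp_perm l w⟩

/-- Sorting a regular residue class. -/
noncomputable def regularResidueEquiv (n K : ℕ) :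
    RegularResidue n K ≃ DominantResidue n K × Equiv.Perm (Fin n) where
  toFun g := (⟨g.1 ∘ Tuple.sort g.1, comp_mem_range_weightResidue g.2.1 _,
    (Tuple.monotone_sort g.1).strictMono_of_injective (g.2.2.comp (Equiv.injective _))⟩,
    (Tuple.sort g.1)⁻¹)
  invFun p := ⟨p.1.1 ∘ p.2, comp_mem_range_weightResidue p.1.2.1 _,
    p.1.2.2.injective.comp (Equiv.injective _)⟩
  left_inv g := by
    ext j
    simp
  right_inv p := by
    have h := sort_comp_perm p.1.2.2.injective p.2
    rw [sort_of_strictMono p.1.2.2, mul_one] at h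
    refine Prod.ext (Subtype.ext ?_) ?_
    · funext j
      simp [h]
    · simp [h]

theorem card_dominantResidue (n k : ℕ) (hn : n ≠ 0) :
    Nat.card (DominantResidue n (k + n)) = (n + k - 1).choose k := by
  obtain ⟨m, rfl⟩ := Nat.exists_eq_succ_of_ne_zero hn
  have h1 := Nat.card_congr (Equiv.ofBijective _
    (liftWeight_bijective (n := m + 1) (K := k + (m + 1)) (by omega)))
  rw [Nat.card_prod, Nat.card_prod, Nat.card_congr (regularResidueEquiv _ _), Nat.card_prod,
    Nat.card_perm] at h1
  simp only [Nat.card_eq_fintype_card, Fintype.card_embedding_eq, Fintype.card_fin] at h1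
  rw [Nat.descFactorial_eq_factorial_mul_choose, ← add_assoc k m 1] at h1
  have h2 := Nat.add_one_mul_choose_eq (k + m) m
  have h3 : (m.succ + k - 1).choose k = (k + m).choose m := by
    rw [show m.succ + k - 1 = k + m by omega, ← Nat.choose_symm_add]
  rw [h3]
  have hpos : 0 < (m + 1).factorial * (k + m + 1) := by positivity
  refine Nat.eq_of_mul_eq_mul_left hpos ?_
  simp only [Nat.succ_eq_add_one, ← add_assoc] at h1 ⊢
  linear_combination -h1 - (m + 1).factorial * h2
/-- The functions on a permutation-stable set of tuples that change by the sign character. -/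
def signEquivariant {n : ℕ} {S : Set (Fin n → ℤ)}
    (hS : ∀ g ∈ S, ∀ w : Equiv.Perm (Fin n), g ∘ w ∈ S) : Submodule ℂ (S → ℂ) where
  carrier := {c | ∀ (w : Equiv.Perm (Fin n)) (g : S),
    c ⟨g.1 ∘ w, hS g.1 g.2 w⟩ = ((Equiv.Perm.sign w : ℤ) : ℂ) * c g}
  add_mem' := by
    intro a b ha hb w g
    simp only [Pi.add_apply, ha w g, hb w g]; ring
  zero_mem' := by
    intro w g; simp
  smul_mem' := by
    intro a c hc w g
    simp only [Pi.smul_apply, hc w g, smul_eq_mul]; ring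

theorem signEquivariant_apply_eq_zero {n : ℕ} {S : Set (Fin n → ℤ)}
    {hS : ∀ g ∈ S, ∀ w : Equiv.Perm (Fin n), g ∘ w ∈ S} {c : S → ℂ}
    (hc : c ∈ signEquivariant hS) (g : S) (hg : ¬ Function.Injective g.1) : c g = 0 := by
  simp only [Function.Injective, not_forall] at hg
  obtain ⟨i, j, hij, hne⟩ := hg
  have hswap : g.1 ∘ Equiv.swap i j = g.1 := by
    rw [Equiv.comp_swap_eq_update, hij, Function.update_eq_self, ← hij, Function.update_eq_self]
  have h := hc (Equiv.swap i j) g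
  rw [Equiv.Perm.sign_swap hne, show (⟨g.1 ∘ Equiv.swap i j, hS g.1 g.2 _⟩ : S) = g from
    Subtype.ext hswap] at h
  push_cast at h
  linear_combination h / 2

theorem sign_mul_self_cast {n : ℕ} (w : Equiv.Perm (Fin n)) :
    ((Equiv.Perm.sign w : ℤ) : ℂ) * ((Equiv.Perm.sign w : ℤ) : ℂ) = 1 := by
  rcases Int.units_eq_one_or (Equiv.Perm.sign w) with h | h <;> simp [h]

theorem finrank_signEquivariant {n : ℕ} {S : Set (Fin n → ℤ)} (hfin : S.Finite)
    (hS : ∀ g ∈ S, ∀ w : Equiv.Perm (Fin n), g ∘ w ∈ S) :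
    Module.finrank ℂ (signEquivariant hS) = Nat.card {g // g ∈ S ∧ StrictMono g} := by
  classical
  have : Finite {g // g ∈ S ∧ StrictMono g} := (hfin.subset fun g hg => hg.1 : Set.Finite _)
  have := Fintype.ofFinite {g // g ∈ S ∧ StrictMono g}
  let r : signEquivariant hS →ₗ[ℂ] ({g // g ∈ S ∧ StrictMono g} → ℂ) :=
    (LinearMap.funLeft ℂ ℂ fun g => (⟨g.1, g.2.1⟩ : S)) ∘ₗ (signEquivariant hS).subtype
  have hmono (g : S) (hg : Function.Injective g.1) : StrictMono (g.1 ∘ Tuple.sort g.1) :=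
    (Tuple.monotone_sort g.1).strictMono_of_injective (hg.comp (Equiv.injective _))
  have hinj : Function.Injective r := by
    rw [← LinearMap.ker_eq_bot, LinearMap.ker_eq_bot']
    intro c hc
    ext g
    by_cases hg : Function.Injective g.1
    · have h1 := c.2 (Tuple.sort g.1) g
      have h2 : c.1 ⟨g.1 ∘ Tuple.sort g.1, hS g.1 g.2 _⟩ = 0 :=
        congrFun hc ⟨g.1 ∘ Tuple.sort g.1, hS g.1 g.2 _, hmono g hg⟩
      rw [h2] at h1
      have h3 := sign_mul_self_cast (Tuple.sort g.1)
      have h4 : c.1 g = 0 := by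
        linear_combination
          -((Equiv.Perm.sign (Tuple.sort g.1) : ℤ) : ℂ) * h1 - c.1 g * h3
      exact h4
    · exact signEquivariant_apply_eq_zero c.2 g hg
  have hsurj : Function.Surjective r := by
    intro d
    let c : S → ℂ := fun g => if hg : Function.Injective g.1 then
      ((Equiv.Perm.sign (Tuple.sort g.1) : ℤ) : ℂ) *
        d ⟨g.1 ∘ Tuple.sort g.1, hS g.1 g.2 _, hmono g hg⟩ else 0
    have hc : c ∈ signEquivariant hS := by
      intro w g
      by_cases hg : Function.Injective g.1
      · have hgw : Function.Injective (g.1 ∘ w) := hg.comp w.injective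
        have hcomp : (g.1 ∘ w) ∘ (w⁻¹ * Tuple.sort g.1 : Equiv.Perm (Fin n)) =
            g.1 ∘ Tuple.sort g.1 := by
          funext i
          simp
        simp only [c, hg, hgw, dif_pos, hcomp, sort_comp_perm hg w, Equiv.Perm.sign_mul,
          Equiv.Perm.sign_inv]
        push_cast
        ring
      · have hgw : ¬ Function.Injective (g.1 ∘ w) := fun h => hg (by
          simpa [Function.comp_assoc] using h.comp (w⁻¹ : Equiv.Perm (Fin n)).injective)
        simp [c, hg, hgw]
    refine ⟨⟨c, hc⟩, funext fun g => ?_⟩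
    have hg : Function.Injective g.1 := g.2.2.injective
    have : r ⟨c, hc⟩ g = c ⟨g.1, g.2.1⟩ := rfl
    rw [this]
    simp [c, hg, sort_of_strictMono g.2.2]
  rw [(LinearEquiv.ofBijective r ⟨hinj, hsurj⟩).finrank_eq, Module.finrank_pi,
    Nat.card_eq_fintype_card]

/-- The weight represented by an integral vector. -/
noncomputable def weightOf {n : ℕ} (l : Fin n → ℤ) : Fin n → ℂ :=
  fun i => (l i : ℂ) - (∑ j, (l j : ℂ)) / n

theorem weightOf_eq_ofReal {n : ℕ} (l : Fin n → ℤ) (i : Fin n) :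
    weightOf l i = (((l i : ℝ) - (∑ j, (l j : ℝ)) / n : ℝ) : ℂ) := by
  simp [weightOf]

theorem weightOf_comp_perm {n : ℕ} (l : Fin n → ℤ) (w : Equiv.Perm (Fin n)) :
    weightOf (l ∘ w) = weightOf l ∘ w := by
  funext j
  simp [weightOf, Equiv.sum_comp w fun i => (l i : ℂ)]

theorem thetaSL_ne_zero {n K : ℕ} (hK : K ≠ 0) {τ : ℂ} (hτ : 0 < τ.im) (r : Fin n → ℝ) :
    thetaSL n τ K (fun i => (r i : ℂ)) ≠ 0 := by
  intro h
  have hK' : (K : ℂ) ≠ 0 := by exact_mod_cast hK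
  have hb : 0 < Real.pi * K * τ.im := by positivity
  have hsum : Summable fun α : {a : Fin n → ℤ // ∑ i, a i = 0} =>
      Complex.exp (Real.pi * Complex.I * (K : ℂ) * τ *
        (∑ i, ((α.1 i : ℂ) + (r i : ℂ) / (K : ℂ)) ^ 2)) := by
    refine Summable.of_norm ?_
    have h1 := (Summable.prod_fin_of_nonneg
      (fun i : Fin n => summable_exp_neg_mul_int_add_sq hb (r i / K))
      (fun i a => (Real.exp_pos _).le)).comp_injective
      (Subtype.val_injective (p := fun a : Fin n → ℤ => ∑ i, a i = 0))
    refine h1.congr fun α => ?_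
    rw [Complex.norm_exp, Function.comp_apply, ← Real.exp_sum, ← Finset.mul_sum]
    congr 1
    have : (∑ i, ((α.1 i : ℂ) + (r i : ℂ) / (K : ℂ)) ^ 2) =
        ((∑ i, ((α.1 i : ℝ) + r i / K) ^ 2 : ℝ) : ℂ) := by push_cast; rfl
    rw [this, show ∀ s : ℝ, (Real.pi : ℂ) * Complex.I * (K : ℂ) * τ * (s : ℂ) =
      ((Real.pi * K * s : ℝ) : ℂ) * (Complex.I * τ) by intro s; push_cast; ring,
      Complex.re_ofReal_mul]
    simp
    ring
  refine Complex.exp_ne_zero _ (eq_zero_of_tsum_mFourier_eq_zero hsum Subtype.val_injective ?_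
    ⟨0, by simp⟩)
  intro x
  choose y hy using fun i => QuotientAddGroup.mk_surjective (x i)
  obtain rfl : (fun i => (y i : UnitAddCircle)) = x := funext hy
  have h1 := congrFun h fun i => (y i : ℂ) / K
  simp only [thetaSL, Pi.zero_apply] at h1
  have hexp := congrArg (Complex.exp
    (-(2 * Real.pi * Complex.I * ∑ i, (r i : ℂ) * (y i : ℂ) / K)) * ·) h1
  simp only [mul_zero, ← tsum_mul_left] at hexp
  refine Eq.trans ?_ hexp
  refine tsum_congr fun α => ?_
  have h2 : UnitAddTorus.mFourier α.1 (fun i => (y i : UnitAddCircle)) =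
      Complex.exp (2 * Real.pi * Complex.I * ∑ i, (α.1 i : ℂ) * (y i : ℂ)) := by
    simp only [UnitAddTorus.mFourier, ContinuousMap.coe_mk, fourier_coe_apply, Finset.mul_sum,
      Complex.exp_sum]
    refine Finset.prod_congr rfl fun i _ => ?_
    congr 1
    push_cast
    ring
  rw [h2, ← Complex.exp_add, ← Complex.exp_add]
  congr 1
  have h3 : (K : ℂ) * ∑ i, ((α.1 i : ℂ) + (r i : ℂ) / K) * ((y i : ℂ) / K) =
      ∑ i, (α.1 i : ℂ) * (y i : ℂ) + ∑ i, (r i : ℂ) * (y i : ℂ) / K := by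
    rw [Finset.mul_sum, ← Finset.sum_add_distrib]
    refine Finset.sum_congr rfl fun i _ => ?_
    field_simp
  linear_combination -(2 * Real.pi * Complex.I) * h3

theorem thetaSL_comp_perm {n K : ℕ} (τ : ℂ) (γ v : Fin n → ℂ) (w : Equiv.Perm (Fin n)) :
    thetaSL n τ K γ (v ∘ w) = thetaSL n τ K (γ ∘ w.symm) v := by
  let e : {a : Fin n → ℤ // ∑ i, a i = 0} ≃ {a : Fin n → ℤ // ∑ i, a i = 0} :=
    (Equiv.arrowCongr w (Equiv.refl ℤ)).subtypeEquiv fun a => by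
      simp [Equiv.arrowCongr, Equiv.sum_comp w.symm a]
  unfold thetaSL
  refine Eq.trans ?_ (e.tsum_eq _)
  refine tsum_congr fun α => ?_
  have he : ∀ i, (e α).1 i = α.1 (w.symm i) := fun i => rfl
  congr 3
  · rw [← Equiv.sum_comp w fun i => (((e α).1 i : ℂ) + (γ ∘ w.symm) i / K) ^ 2]
    simp [he]
  · rw [← Equiv.sum_comp w fun i => (((e α).1 i : ℂ) + (γ ∘ w.symm) i / K) * v i]
    simp [he]

theorem thetaSL_add_period {n K : ℕ} (hK : K ≠ 0) (τ : ℂ) (γ v : Fin n → ℂ) (h : Fin n → ℤ) :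
    thetaSL n τ K γ (fun i => v i + h i / K) =
      Complex.exp (2 * Real.pi * Complex.I * ∑ i, γ i * h i / K) * thetaSL n τ K γ v := by
  have hK' : (K : ℂ) ≠ 0 := by exact_mod_cast hK
  unfold thetaSL
  rw [← tsum_mul_left]
  refine tsum_congr fun α => ?_
  rw [← Complex.exp_add, Complex.exp_eq_exp_iff_exists_int]
  refine ⟨∑ i, α.1 i * h i, ?_⟩
  have h3 : (K : ℂ) * ∑ i, ((α.1 i : ℂ) + γ i / K) * (v i + h i / K) =
      K * ∑ i, ((α.1 i : ℂ) + γ i / K) * v i + ∑ i, γ i * h i / K +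
        ∑ i, (α.1 i : ℂ) * h i := by
    rw [Finset.mul_sum, Finset.mul_sum, ← Finset.sum_add_distrib, ← Finset.sum_add_distrib]
    refine Finset.sum_congr rfl fun i _ => ?_
    field_simp
    ring
  push_cast
  linear_combination (2 * Real.pi * Complex.I) * h3

theorem thetaSL_congr {n K : ℕ} (hn : n ≠ 0) (hK : K ≠ 0) (τ : ℂ) {l l' : Fin n → ℤ}
    (h : weightResidue n K l = weightResidue n K l') :
    thetaSL n τ K (weightOf l) = thetaSL n τ K (weightOf l') := by
  have hK' : (K : ℂ) ≠ 0 := by exact_mod_cast hK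
  have hn' : (n : ℂ) ≠ 0 := by exact_mod_cast hn
  choose β hβ using weightResidue_eq_iff.1 h
  have hβ0 : ∑ j, β j = 0 := by
    have h1 : (n * K : ℤ) * ∑ j, β j = 0 := by
      rw [Finset.mul_sum, ← Finset.sum_congr rfl fun j _ => hβ j]
      simp [Finset.sum_sub_distrib, ← Finset.mul_sum]
    have h2 : (n * K : ℤ) ≠ 0 := by positivity
    exact (mul_eq_zero.1 h1).resolve_left h2
  have hw : ∀ j, weightOf l' j / K = weightOf l j / K + β j := by
    intro j
    have := congrArg (Int.cast : ℤ → ℂ) (hβ j)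
    push_cast at this
    simp only [weightOf]
    field_simp
    linear_combination this
  let e : {a : Fin n → ℤ // ∑ i, a i = 0} ≃ {a : Fin n → ℤ // ∑ i, a i = 0} :=
    (Equiv.addRight β).subtypeEquiv fun a => by
      simp [Finset.sum_add_distrib, hβ0]
  funext v
  unfold thetaSL
  rw [← e.tsum_eq]
  refine tsum_congr fun α => ?_
  have he : ∀ i, (((e α).1 i : ℤ) : ℂ) + weightOf l i / K = α.1 i + weightOf l' i / K := by
    intro i
    rw [hw, show (e α).1 i = α.1 i + β i from rfl]
    push_cast
    ring
  simp only [he]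

/-- The theta function attached to a residue class of weights. -/
noncomputable def thetaResidue (n K : ℕ) (τ : ℂ) (g : Set.range (weightResidue n K)) :
    (Fin n → ℂ) → ℂ :=
  thetaSL n τ K (weightOf g.2.choose)

theorem thetaResidue_mk {n K : ℕ} (hn : n ≠ 0) (hK : K ≠ 0) (τ : ℂ) (l : Fin n → ℤ)
    (h : weightResidue n K l ∈ Set.range (weightResidue n K)) :
    thetaResidue n K τ ⟨weightResidue n K l, h⟩ = thetaSL n τ K (weightOf l) :=
  thetaSL_congr hn hK τ h.choose_spec

/-- The character through which translations by `K⁻¹ ℤⁿ` act on a theta function. -/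
noncomputable def periodCharacter {n : ℕ} (K : ℕ) (γ : Fin n → ℂ) :
    Multiplicative (Fin n → ℤ) →* ℂ where
  toFun h := Complex.exp (2 * Real.pi * Complex.I * ∑ i, γ i * (h.toAdd i : ℂ) / K)
  map_one' := by simp
  map_mul' a b := by
    rw [← Complex.exp_add, ← mul_add, ← Finset.sum_add_distrib]
    congr 2
    refine Finset.sum_congr rfl fun i _ => ?_
    simp only [toAdd_mul, Pi.add_apply]
    push_cast
    ring

theorem weightResidue_eq_of_periodCharacter_eq {n K : ℕ} (hn : n ≠ 0) (hK : K ≠ 0)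
    {l l' : Fin n → ℤ}
    (h : periodCharacter K (weightOf l) = periodCharacter K (weightOf l')) :
    weightResidue n K l = weightResidue n K l' := by
  have hK' : (K : ℂ) ≠ 0 := by exact_mod_cast hK
  have hn' : (n : ℂ) ≠ 0 := by exact_mod_cast hn
  refine weightResidue_eq_iff.2 fun j => ?_
  have h1 : Complex.exp (2 * Real.pi * Complex.I * (weightOf l' j / K)) =
      Complex.exp (2 * Real.pi * Complex.I * (weightOf l j / K)) := by
    have := DFunLike.congr_fun h (Multiplicative.ofAdd (Pi.single j 1))
    simpa [periodCharacter, Pi.single_apply, ite_div] using this.symm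
  obtain ⟨m, hm⟩ := Complex.exp_eq_exp_iff_exists_int.1 h1
  refine ⟨m, ?_⟩
  have h2 : weightOf l' j / K = weightOf l j / K + m := by
    refine mul_left_cancel₀ Complex.two_pi_I_ne_zero ?_
    linear_combination hm
  simp only [weightOf] at h2
  field_simp at h2
  have h3 : ((n * l' j - ∑ i, l' i - (n * l j - ∑ i, l i) : ℤ) : ℂ) = ((n * K * m : ℤ) : ℂ) := by
    push_cast
    linear_combination h2
  exact_mod_cast h3

theorem linearIndependent_thetaResidue {n K : ℕ} (hn : n ≠ 0) (hK : K ≠ 0) {τ : ℂ}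
    (hτ : 0 < τ.im) : LinearIndependent ℂ (thetaResidue n K τ) := by
  have : Finite (Set.range (weightResidue n K)) := finite_range_weightResidue hn hK
  have := Fintype.ofFinite (Set.range (weightResidue n K))
  have hinj : Function.Injective fun g : Set.range (weightResidue n K) =>
      periodCharacter K (weightOf g.2.choose) := fun g g' h => Subtype.ext
    (g.2.choose_spec.symm.trans
      ((weightResidue_eq_of_periodCharacter_eq hn hK h).trans g'.2.choose_spec))
  have hchar := (linearIndependent_monoidHom (Multiplicative (Fin n → ℤ)) ℂ).comp _ hinj
  rw [Fintype.linearIndependent_iff] at hchar ⊢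
  intro c hc g
  have hz (v : Fin n → ℂ) : c g * thetaResidue n K τ g v = 0 := by
    refine hchar (fun g => c g * thetaResidue n K τ g v) (funext fun h => ?_) g
    have := congrFun hc fun i => v i + (h.toAdd i : ℂ) / K
    simp only [Finset.sum_apply, Pi.smul_apply, smul_eq_mul, Pi.zero_apply] at this ⊢
    rw [← this]
    refine Finset.sum_congr rfl fun g _ => ?_
    rw [thetaResidue, thetaSL_add_period hK]
    rw [mul_left_comm, mul_comm]
    rfl
  by_contra hcg
  refine thetaSL_ne_zero hK hτ
    (fun i => (g.2.choose i : ℝ) - (∑ j, (g.2.choose j : ℝ)) / n) ?_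
  simp_rw [← weightOf_eq_ofReal]
  exact funext fun v => (mul_eq_zero.1 (hz v)).resolve_left hcg

theorem thetaResidue_comp_perm {n K : ℕ} (hn : n ≠ 0) (hK : K ≠ 0) (τ : ℂ)
    (g : Set.range (weightResidue n K)) (w : Equiv.Perm (Fin n)) (v : Fin n → ℂ) :
    thetaResidue n K τ ⟨g.1 ∘ w, comp_mem_range_weightResidue g.2 w⟩ (v ∘ w) =
      thetaResidue n K τ g v := by
  obtain ⟨g, hg⟩ := g
  obtain ⟨l, rfl⟩ := id hg
  have h : (⟨weightResidue n K l ∘ w, comp_mem_range_weightResidue hg w⟩ :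
      Set.range (weightResidue n K)) = ⟨weightResidue n K (l ∘ w), Set.mem_range_self _⟩ :=
    Subtype.ext (weightResidue_comp_perm l w).symm
  rw [h, thetaResidue_mk hn hK, thetaResidue_mk hn hK, thetaSL_comp_perm, weightOf_comp_perm]
  simp [Function.comp_assoc]

theorem span_thetaResidue {n K : ℕ} (hn : n ≠ 0) (hK : K ≠ 0) (τ : ℂ) :
    Submodule.span ℂ {f : (Fin n → ℂ) → ℂ | ∃ γ ∈ weightLatticeC n, f = thetaSL n τ K γ} =
      Submodule.span ℂ (Set.range (thetaResidue n K τ)) := by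
  congr 1
  ext f
  constructor
  · rintro ⟨_, ⟨l, rfl⟩, rfl⟩
    exact ⟨_, thetaResidue_mk hn hK τ l ⟨l, rfl⟩⟩
  · rintro ⟨g, rfl⟩
    exact ⟨_, ⟨_, rfl⟩, rfl⟩

theorem sum_smul_thetaResidue_mem_antiInvSub_iff {n K : ℕ} (hn : n ≠ 0) (hK : K ≠ 0) {τ : ℂ}
    (hτ : 0 < τ.im) [Fintype (Set.range (weightResidue n K))]
    (c : Set.range (weightResidue n K) → ℂ) :
    ∑ g, c g • thetaResidue n K τ g ∈ antiInvSub n ↔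
      c ∈ signEquivariant (fun _ hg w => comp_mem_range_weightResidue (n := n) (K := K) hg w) := by
  have hind := linearIndependent_thetaResidue hn hK hτ
  have key (w : Equiv.Perm (Fin n)) (v : Fin n → ℂ) :
      (∑ g, c g • thetaResidue n K τ g) (v ∘ w) =
        (∑ g, c ⟨g.1 ∘ w, comp_mem_range_weightResidue g.2 w⟩ • thetaResidue n K τ g) v := by
    let e : Set.range (weightResidue n K) ≃ Set.range (weightResidue n K) :=
      { toFun := fun g => ⟨g.1 ∘ w, comp_mem_range_weightResidue g.2 w⟩
        invFun := fun g => ⟨g.1 ∘ w.symm, comp_mem_range_weightResidue g.2 w.symm⟩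
        left_inv := fun g => by simp [Function.comp_assoc]
        right_inv := fun g => by simp [Function.comp_assoc] }
    rw [← e.sum_comp]
    simp only [Finset.sum_apply, Pi.smul_apply, smul_eq_mul]
    refine Finset.sum_congr rfl fun g _ => ?_
    exact congrArg _ (thetaResidue_comp_perm hn hK τ g w v)
  constructor
  · intro h w
    have h1 : ∑ g, c ⟨g.1 ∘ w, comp_mem_range_weightResidue g.2 w⟩ • thetaResidue n K τ g =
        ∑ g, (((Equiv.Perm.sign w : ℤ) : ℂ) * c g) • thetaResidue n K τ g := by
      funext v
      rw [← key]
      refine (h w v).trans ?_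
      simp [Finset.mul_sum, mul_assoc]
    intro g
    exact Fintype.linearIndependent_iffₛ.1 hind _ _ h1 g
  · intro h w v
    refine (key w v).trans ?_
    simp only [Finset.sum_apply, Pi.smul_apply, smul_eq_mul, Finset.mul_sum, ← mul_assoc]
    exact Finset.sum_congr rfl fun g _ => by rw [h w g]

/-- For `n ≥ 3`, `k ≥ 0` and `k' = k + n`, the space of Weyl anti-invariant elements in the
span of the theta functions `θ_{γ,k'}`, `γ ∈ Λ_W`, has dimension equal to the Verlinde
number `binom(n+k−1, k)`. -/
theorem statement_16 (n k : ℕ) (hn : 3 ≤ n) (τ : ℂ) (hτ : 0 < τ.im) :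
    Module.finrank ℂ
      ↥(Submodule.span ℂ
          {f : (Fin n → ℂ) → ℂ | ∃ γ ∈ weightLatticeC n, f = thetaSL n τ (k + n) γ} ⊓
        antiInvSub n) = Nat.choose (n + k - 1) k := by
  have hn0 : n ≠ 0 := by omega
  have hK : k + n ≠ 0 := by omega
  have hfin := finite_range_weightResidue (n := n) (K := k + n) hn0 hK
  have : Finite (Set.range (weightResidue n (k + n))) := hfin
  have := Fintype.ofFinite (Set.range (weightResidue n (k + n)))
  let T : (Set.range (weightResidue n (k + n)) → ℂ) →ₗ[ℂ] (Fin n → ℂ) → ℂ :=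
    Fintype.linearCombination ℂ (thetaResidue n (k + n) τ)
  have hT : Function.Injective T :=
    (linearIndependent_thetaResidue hn0 hK hτ).fintypeLinearCombination_injective
  have hmap : Submodule.span ℂ {f : (Fin n → ℂ) → ℂ |
      ∃ γ ∈ weightLatticeC n, f = thetaSL n τ (k + n) γ} ⊓ antiInvSub n =
      (signEquivariant (fun _ hg w =>
        comp_mem_range_weightResidue (n := n) (K := k + n) hg w)).map T := by
    rw [span_thetaResidue hn0 hK, ← Fintype.range_linearCombination ℂ, ← Submodule.map_comap_eq]
    congr 1
    ext c
    exact sum_smul_thetaResidue_mem_antiInvSub_iff hn0 hK hτ c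
  rw [hmap, (Submodule.equivMapOfInjective T hT _).symm.finrank_eq,
    finrank_signEquivariant hfin, card_dominantResidue n k hn0]
end

section
/- Let l ≥ 2, n = l + 1, and let C be the Cartan matrix of the root system A_l (C_{ii} = 2, C_{ij} = −1 if |i−j| = 1, C_{ij} = 0 otherwise). Let A be the l×l integer matrix whose j-th column is the standard basis vector e_j for j ≤ l−1 and whose last column is (l, l−1, …, 2, 1)ᵗ, and let Δ = diag(1,…,1,n). Then: (i) det A = 1; (ii) the matrix Ã whose j-th column is C^{−1}(e_j − (n−j)e_l) for j ≤ l−1 and C^{−1}(n e_l) for j = l has integer entries and det Ã = 1; (iii) AᵗCÃ = Δ; and (iv) the symmetric matrix Ω₀ = A^{−1}C^{−1}(Aᵗ)^{−1} has entries Ω₀_{ij} = (n−i)(l−j) for i ≤ j ≤ l−1, Ω₀_{il} = Ω₀_{li} = i − l for i ≤ l−1, and Ω₀_{ll} = l/n, so that the period matrix of the canonical basis is Ω = τΩ₀. -/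
open Matrix

/-- The Cartan matrix of the root system `A_l`, over `ℚ`. -/
def cartanA (l : ℕ) : Matrix (Fin l) (Fin l) ℚ :=
  Matrix.of fun i j =>
    if i = j then 2 else if ((i : ℤ) - (j : ℤ)).natAbs = 1 then -1 else 0

/-- The matrix `A` whose `j`-th column is `e_j` for `j ≤ l−1` (in 1-indexed terms) and whose
last column is `(l, l−1, …, 2, 1)ᵗ`. -/
def matA (l : ℕ) : Matrix (Fin l) (Fin l) ℚ :=
  Matrix.of fun i j =>
    if (j : ℕ) = l - 1 then ((l : ℚ) - (i : ℕ)) else if i = j then 1 else 0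

/-- The matrix `B` with columns `e_j − (n−j)e_l` (1-indexed, `j ≤ l−1`) and `n e_l`,
so that `Ã = C⁻¹B`. -/
def matB (l n : ℕ) : Matrix (Fin l) (Fin l) ℚ :=
  Matrix.of fun i j =>
    if (j : ℕ) = l - 1 then (if (i : ℕ) = l - 1 then (n : ℚ) else 0)
    else (if i = j then 1 else 0) -
      (if (i : ℕ) = l - 1 then ((n : ℚ) - (j : ℕ) - 1) else 0)

lemma matA_isUpperTriangular (l : ℕ) : (matA l).IsUpperTriangular := by
  intro i j hij
  simp only [id, Fin.lt_def] at hij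
  have h1 : (j : ℕ) ≠ l - 1 := by omega
  have h2 : i ≠ j := by
    rintro rfl
    omega
  simp [matA, h1, h2]

lemma det_matA (l : ℕ) : (matA l).det = 1 := by
  rw [det_of_isUpperTriangular (matA_isUpperTriangular l)]
  refine Finset.prod_eq_one fun i _ => ?_
  by_cases h : (i : ℕ) = l - 1
  · have hl : (l : ℚ) = (i : ℕ) + 1 := by
      have := i.isLt
      exact_mod_cast (by omega : l = (i : ℕ) + 1)
    simp [matA, h, hl]
  · simp [matA, h]

lemma cartanA_transpose (l : ℕ) : (cartanA l)ᵀ = cartanA l := by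
  ext i j
  have h : ((j : ℤ) - (i : ℤ)).natAbs = ((i : ℤ) - (j : ℤ)).natAbs := by omega
  simp only [cartanA, transpose_apply, of_apply, h, eq_comm (a := j)]

/-- The Cartan matrix of `A_l` acts as the negative discrete Laplacian. -/
lemma cartanA_sum (l : ℕ) (f : ℕ → ℚ) (i : Fin l) :
    ∑ k : Fin l, cartanA l i k * f k =
      2 * f i - (if 0 < (i : ℕ) then f (i - 1) else 0)
        - (if (i : ℕ) + 1 < l then f (i + 1) else 0) := by
  have hi := i.isLt
  have key : ∀ k : Fin l, cartanA l i k * f k =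
      (if (k : ℕ) = i then 2 * f i else 0) -
        (if (k : ℕ) + 1 = i then f (i - 1) else 0) -
        (if (k : ℕ) = i + 1 then f (i + 1) else 0) := by
    intro k
    simp only [cartanA, of_apply, Fin.ext_iff]
    rcases lt_trichotomy (k : ℕ) i with h | h | h
    · by_cases h' : (k : ℕ) + 1 = i
      · have e : (k : ℕ) = i - 1 := by omega
        rw [if_neg (by omega), if_pos (by omega), if_neg (by omega), if_pos h',
          if_neg (by omega), e]
        ring
      · rw [if_neg (by omega), if_neg (by omega), if_neg (by omega), if_neg h',
          if_neg (by omega)]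
        ring
    · rw [if_pos h.symm, if_pos h, if_neg (by omega), if_neg (by omega), h]
      ring
    · by_cases h' : (k : ℕ) = i + 1
      · rw [if_neg (by omega), if_pos (by omega), if_neg (by omega), if_neg (by omega),
          if_pos h', h']
        ring
      · rw [if_neg (by omega), if_neg (by omega), if_neg (by omega), if_neg (by omega),
          if_neg h']
        ring
  simp only [key, Finset.sum_sub_distrib]
  congr 1
  · congr 1
    · rw [Finset.sum_eq_single i (fun k _ hk => if_neg fun h => hk (Fin.ext h)) (by simp)]
      simp
    · split_ifs with h
      · rw [Finset.sum_eq_single ⟨i - 1, by omega⟩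
          (fun k _ hk => if_neg fun h => hk (Fin.ext (by simp only; omega))) (by simp)]
        exact if_pos (by simp only; omega)
      · exact Finset.sum_eq_zero fun k _ => if_neg (by omega)
  · split_ifs with h
    · rw [Finset.sum_eq_single ⟨i + 1, h⟩
        (fun k _ hk => if_neg fun h => hk (Fin.ext h)) (by simp)]
      exact if_pos rfl
    · exact Finset.sum_eq_zero fun k _ => if_neg (by omega)

lemma cartanA_mul_of (l : ℕ) (f : ℕ → ℕ → ℚ) (i j : Fin l) :
    (cartanA l * Matrix.of fun i j : Fin l => f i j) i j =
      2 * f i j - (if 0 < (i : ℕ) then f (i - 1) j else 0)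
        - (if (i : ℕ) + 1 < l then f (i + 1) j else 0) := by
  simp only [mul_apply, of_apply]
  exact cartanA_sum l (fun k => f k j) i

lemma det_cartanA (l : ℕ) : (cartanA l).det = (l : ℚ) + 1 := by
  let f : ℕ → ℕ → ℚ := fun i j => if i ≤ j then ((i : ℚ) + 1) / ((j : ℚ) + 1) else 0
  let P : Matrix (Fin l) (Fin l) ℚ := Matrix.of fun i j => f i j
  have hP : P.det = 1 := by
    rw [det_of_isUpperTriangular (M := P)]
    · refine Finset.prod_eq_one fun i _ => ?_
      simp only [P, f, of_apply, le_refl, if_true]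
      exact div_self (by positivity)
    · intro i j hij
      simp only [id, Fin.lt_def] at hij
      simp only [P, f, of_apply]
      exact if_neg (by omega)
  have hlow : (cartanA l * P).IsLowerTriangular := by
    intro i j hij
    replace hij : (i : ℕ) < j := hij
    have hj := j.isLt
    rw [cartanA_mul_of]
    simp only [f]
    rw [if_pos (by omega : (i : ℕ) ≤ j), if_pos (by omega : (i : ℕ) + 1 < l),
      if_pos (by omega : (i : ℕ) + 1 ≤ j), if_pos (by omega : (i : ℕ) - 1 ≤ j)]
    split_ifs with h
    · push_cast [Nat.cast_sub (by omega : 1 ≤ (i : ℕ))]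
      ring
    · have : (i : ℕ) = 0 := by omega
      simp [this]
      ring
  have hdiag : ∀ i : Fin l, (cartanA l * P) i i = (((i : ℕ) + 1 : ℕ) + 1 : ℚ) / ((i : ℕ) + 1) := by
    intro i
    have hi : ((i : ℕ) : ℚ) + 1 ≠ 0 := by positivity
    rw [cartanA_mul_of]
    simp only [f]
    rw [if_pos le_rfl, if_neg (by omega : ¬ (i : ℕ) + 1 ≤ i),
      if_pos (by omega : (i : ℕ) - 1 ≤ i), ite_self]
    split_ifs with h
    · push_cast [Nat.cast_sub (by omega : 1 ≤ (i : ℕ))]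
      field_simp
      ring
    · have : (i : ℕ) = 0 := by omega
      simp [this]
      norm_num
  have htel : ∀ m : ℕ, ∏ i ∈ Finset.range m, (((i + 1 : ℕ) + 1 : ℚ) / (i + 1)) = m + 1 := by
    intro m
    induction m with
    | zero => simp
    | succ m ih =>
      have hm : (m : ℚ) + 1 ≠ 0 := by positivity
      rw [Finset.prod_range_succ, ih]
      field_simp
  have h := det_of_isLowerTriangular _ hlow
  rw [det_mul, hP, mul_one] at h
  rw [h, Finset.prod_congr rfl fun i _ => hdiag i,
    Fin.prod_univ_eq_prod_range (fun i : ℕ => (((i + 1 : ℕ) + 1 : ℚ) / (i + 1))) l, htel]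

/-- The integer matrix `C⁻¹B`, in closed form. -/
def matATilde (l : ℕ) : Matrix (Fin l) (Fin l) ℤ :=
  Matrix.of fun i j =>
    if (j : ℕ) = l - 1 then (i : ℤ) + 1 else if (i : ℕ) ≤ j then 0 else (j : ℤ) - i

lemma cartanA_mul_matATilde (l : ℕ) :
    cartanA l * (matATilde l).map (Int.cast : ℤ → ℚ) = matB l (l + 1) := by
  let f : ℕ → ℕ → ℚ := fun i j =>
    if j = l - 1 then (i : ℚ) + 1 else if i ≤ j then 0 else (j : ℚ) - i
  have hof : (matATilde l).map (Int.cast : ℤ → ℚ) = Matrix.of fun i j : Fin l => f i j := by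
    ext i j
    simp only [f, matATilde, map_apply, of_apply]
    split_ifs <;> push_cast <;> rfl
  ext i j
  have hi := i.isLt
  have hj := j.isLt
  rw [hof, cartanA_mul_of]
  simp only [f, matB, of_apply, Fin.ext_iff]
  obtain ⟨a, ha⟩ := i
  obtain ⟨b, hb⟩ := j
  obtain ⟨m, rfl⟩ : ∃ m, l = m + 1 := ⟨l - 1, by omega⟩
  simp only [Nat.add_sub_cancel] at *
  rcases Nat.eq_zero_or_pos a with rfl | h0
  · split_ifs <;> first | omega | skip
    all_goals
      try have : b = 0 := by omega
      try subst_vars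
      push_cast
      try ring
  · obtain ⟨a, rfl⟩ : ∃ c, a = c + 1 := ⟨a - 1, by omega⟩
    simp only [Nat.add_sub_cancel]
    split_ifs <;> first | omega | skip
    all_goals
      try have : a = b := by omega
      try have : a + 1 = b := by omega
      try subst_vars
      push_cast
      try ring

/-- The matrix `Ω₀`, in closed form. -/
def matOmega (l : ℕ) : Matrix (Fin l) (Fin l) ℚ :=
  Matrix.of fun i j =>
    if (j : ℕ) = l - 1 then
      if (i : ℕ) = l - 1 then (l : ℚ) / (l + 1) else (i : ℚ) + 1 - l
    else if (i : ℕ) = l - 1 then (j : ℚ) + 1 - l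
    else if (i : ℕ) ≤ j then ((l : ℚ) - i) * ((l : ℚ) - j - 1)
    else ((l : ℚ) - j) * ((l : ℚ) - i - 1)

/-- The elementary divisor matrix `diag(1, …, 1, l + 1)`. -/
abbrev matDelta (l : ℕ) : Matrix (Fin l) (Fin l) ℚ :=
  Matrix.diagonal fun i : Fin l => if (i : ℕ) = l - 1 then ((l + 1 : ℕ) : ℚ) else 1

lemma det_matDelta (l : ℕ) (hl : 1 ≤ l) : (matDelta l).det = (l : ℚ) + 1 := by
  rw [det_diagonal, Finset.prod_eq_single ⟨l - 1, by omega⟩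
    (fun k _ hk => if_neg fun h => hk (Fin.ext h)) (by simp)]
  simp

lemma matA_transpose_mul_matB (l : ℕ) : (matA l)ᵀ * matB l (l + 1) = matDelta l := by
  ext i j
  have hi := i.isLt
  have hj := j.isLt
  rw [mul_apply]
  simp only [transpose_apply, diagonal_apply]
  by_cases h : (i : ℕ) = l - 1
  · by_cases hjl : (j : ℕ) = l - 1
    · have hij : i = j := Fin.ext (by omega)
      subst hij
      rw [Finset.sum_eq_single i]
      · have : (l : ℚ) = (i : ℕ) + 1 := by exact_mod_cast (by omega : l = (i : ℕ) + 1)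
        simp only [matA, matB, of_apply, if_pos h, if_true, this]
        push_cast
        ring
      · intro k _ hk
        have : (k : ℕ) ≠ l - 1 := fun h' => hk (Fin.ext (by omega))
        simp [matB, this, hjl]
      · simp
    · have hij : i ≠ j := fun e => hjl (e ▸ h)
      rw [if_neg hij, ← Finset.sum_subset (Finset.subset_univ {i, j}), Finset.sum_pair hij]
      · have : (l : ℚ) = (i : ℕ) + 1 := by exact_mod_cast (by omega : l = (i : ℕ) + 1)
        simp only [matA, matB, of_apply, if_pos h, if_neg hjl, if_neg hij, if_true]
        push_cast
        rw [this]
        ring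
      · intro k _ hk
        simp only [Finset.mem_insert, Finset.mem_singleton, not_or] at hk
        have : (k : ℕ) ≠ l - 1 := fun h' => hk.1 (Fin.ext (by omega))
        simp [matB, this, hjl, hk.2]
  · rw [Finset.sum_eq_single i]
    · by_cases hij : i = j
      · subst hij
        simp [matA, matB, h]
      · simp [matA, matB, h, hij]
    · intro k _ hk
      simp [matA, h, hk]
    · simp

lemma matA_mul_apply (l : ℕ) (M : Matrix (Fin l) (Fin l) ℚ) (i j t : Fin l)
    (ht : (t : ℕ) = l - 1) :
    (matA l * M) i j =
      if i = t then M t j else M i j + ((l : ℚ) - i) * M t j := by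
  have htl : (l : ℚ) = (t : ℕ) + 1 := by
    have := t.isLt
    exact_mod_cast (by omega : l = (t : ℕ) + 1)
  have hne : ∀ k : Fin l, k ≠ t → (k : ℕ) ≠ l - 1 := fun k hk h => hk (Fin.ext (by omega))
  rw [mul_apply]
  split_ifs with h
  · subst h
    rw [Finset.sum_eq_single i]
    · simp only [matA, of_apply, if_pos ht]
      rw [htl]
      ring
    · intro k _ hk
      simp [matA, hne k hk, hk.symm]
    · simp
  · rw [← Finset.sum_subset (Finset.subset_univ {i, t}), Finset.sum_pair h]
    · simp [matA, hne i h, ht]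
    · intro k _ hk
      simp only [Finset.mem_insert, Finset.mem_singleton, not_or] at hk
      simp [matA, hne k hk.2, Ne.symm hk.1]

lemma matA_mul_matOmega_mul_matDelta (l : ℕ) :
    matA l * (matOmega l * matDelta l) = (matATilde l).map (Int.cast : ℤ → ℚ) := by
  ext i j
  obtain ⟨m, rfl⟩ : ∃ m, l = m + 1 := ⟨l - 1, by have := i.isLt; omega⟩
  have hm : (m : ℚ) + 1 + 1 ≠ 0 := by positivity
  rw [matA_mul_apply _ _ i j (Fin.last m) (by simp)]
  simp only [mul_diagonal, matOmega, matATilde, of_apply, map_apply, Fin.ext_iff, Fin.val_last,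
    Nat.add_sub_cancel]
  have hi := i.isLt
  have hj := j.isLt
  split_ifs <;> first | omega | skip
  all_goals
    try simp only [*]
    push_cast
    field_simp
    try ring

lemma cartanA_inv_mul_matB (l : ℕ) :
    (cartanA l)⁻¹ * matB l (l + 1) = (matATilde l).map (Int.cast : ℤ → ℚ) := by
  have hC : IsUnit (cartanA l).det := by
    rw [det_cartanA]
    exact (by positivity : (l : ℚ) + 1 ≠ 0).isUnit
  rw [← cartanA_mul_matATilde, nonsing_inv_mul_cancel_left _ _ hC]

lemma matA_inv_mul_cartanA_inv_mul_transpose_inv (l : ℕ) (hl : 1 ≤ l) :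
    (matA l)⁻¹ * (cartanA l)⁻¹ * ((matA l)ᵀ)⁻¹ = matOmega l := by
  have hA : IsUnit (matA l).det := by simp [det_matA]
  have hAt : IsUnit (matA l)ᵀ.det := by simp [det_matA]
  have hD : IsUnit (matDelta l).det := by
    rw [det_matDelta l hl]
    exact (by positivity : (l : ℚ) + 1 ≠ 0).isUnit
  have h : (matA l)⁻¹ * (cartanA l)⁻¹ * ((matA l)ᵀ)⁻¹ * matDelta l =
      matOmega l * matDelta l := by
    rw [← matA_transpose_mul_matB, Matrix.mul_assoc, nonsing_inv_mul_cancel_left _ _ hAt,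
      Matrix.mul_assoc, cartanA_inv_mul_matB, ← matA_mul_matOmega_mul_matDelta,
      nonsing_inv_mul_cancel_left _ _ hA, matA_transpose_mul_matB]
  rw [← mul_nonsing_inv_cancel_right _ ((matA l)⁻¹ * (cartanA l)⁻¹ * ((matA l)ᵀ)⁻¹) hD, h,
    mul_nonsing_inv_cancel_right _ _ hD]

/-- Explicit canonical basis for `Λ_R ⊕ τΛ_R` for `sl(n,ℂ)`, `n = l+1 ≥ 3`: with
`A = matA l`, `Ã = (cartanA l)⁻¹ · matB l n` and `Δ = diag(1,…,1,n)` one has `det A = 1`,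
`Ã` integral with `det Ã = 1`, `AᵗCÃ = Δ`, and the (symmetric) matrix
`Ω₀ = A⁻¹C⁻¹(Aᵗ)⁻¹` has the indicated entries, so that the period matrix is `Ω = τΩ₀`. -/
theorem statement_18 (l : ℕ) (hl : 2 ≤ l) (n : ℕ) (hn : n = l + 1) :
    (matA l).det = 1 ∧
    ((∀ i j : Fin l, ∃ z : ℤ, ((cartanA l)⁻¹ * matB l n) i j = (z : ℚ)) ∧
      ((cartanA l)⁻¹ * matB l n).det = 1) ∧
    (matA l)ᵀ * cartanA l * ((cartanA l)⁻¹ * matB l n) =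
      Matrix.diagonal (fun i : Fin l => if (i : ℕ) = l - 1 then (n : ℚ) else 1) ∧
    (((matA l)⁻¹ * (cartanA l)⁻¹ * ((matA l)ᵀ)⁻¹)ᵀ =
        (matA l)⁻¹ * (cartanA l)⁻¹ * ((matA l)ᵀ)⁻¹ ∧
      (∀ i j : Fin l, (i : ℕ) ≤ (j : ℕ) → (j : ℕ) < l - 1 →
        ((matA l)⁻¹ * (cartanA l)⁻¹ * ((matA l)ᵀ)⁻¹) i j =
          ((n : ℚ) - (i : ℕ) - 1) * ((l : ℚ) - (j : ℕ) - 1)) ∧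
      (∀ i : Fin l, (i : ℕ) < l - 1 →
        ((matA l)⁻¹ * (cartanA l)⁻¹ * ((matA l)ᵀ)⁻¹) i ⟨l - 1, by omega⟩ =
          ((i : ℕ) : ℚ) + 1 - (l : ℚ)) ∧
      ((matA l)⁻¹ * (cartanA l)⁻¹ * ((matA l)ᵀ)⁻¹) ⟨l - 1, by omega⟩ ⟨l - 1, by omega⟩ =
        (l : ℚ) / (n : ℚ)) := by
  subst hn
  have hC0 : (l : ℚ) + 1 ≠ 0 := by positivity
  have hC : IsUnit (cartanA l).det := by
    rw [det_cartanA]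
    exact hC0.isUnit
  refine ⟨det_matA l, ⟨fun i j => ⟨matATilde l i j, ?_⟩, ?_⟩, ?_, ?_, ?_, ?_, ?_⟩
  · rw [cartanA_inv_mul_matB, map_apply]
  · have hB : (matB l (l + 1)).det = (l : ℚ) + 1 := by
      rw [← det_matDelta l (by omega), ← matA_transpose_mul_matB, det_mul, det_transpose,
        det_matA, one_mul]
    rw [det_mul, det_nonsing_inv, det_cartanA, hB, Ring.inverse_mul_cancel _ hC0.isUnit]
  · rw [Matrix.mul_assoc, mul_nonsing_inv_cancel_left _ _ hC, matA_transpose_mul_matB]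
  · rw [transpose_mul, transpose_mul, transpose_nonsing_inv, transpose_nonsing_inv,
      transpose_nonsing_inv, transpose_transpose, cartanA_transpose, Matrix.mul_assoc]
  · intro i j hij hj
    rw [matA_inv_mul_cartanA_inv_mul_transpose_inv l (by omega)]
    simp only [matOmega, of_apply]
    rw [if_neg (by omega), if_neg (by omega), if_pos hij]
    push_cast
    ring
  · intro i hi
    rw [matA_inv_mul_cartanA_inv_mul_transpose_inv l (by omega)]
    simp only [matOmega, of_apply, if_true]
    rw [if_neg (by omega)]
  · rw [matA_inv_mul_cartanA_inv_mul_transpose_inv l (by omega)]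
    simp [matOmega]
end

section
/- Let l ≥ 2, let n ≥ 1 be an integer, and let Δ = diag(1,…,1,n) be the l×l diagonal matrix. Then for B ∈ SL(l,ℤ): there exists B̃ ∈ SL(l,ℤ) with BᵗΔB̃ = Δ if and only if n divides the entry B_{i,l} for every i ∈ {1,…,l−1}. Moreover, the set Γ_n of all such B is a subgroup of SL(l,ℤ), and if Ω₁ is a period matrix and Ω₂ = A₂^{−1}C^{−1}(A₂ᵗ)^{−1}·τ with A₂ = A₁B^{−1} for some B ∈ Γ_n, then Ω₂ = BΩ₁Bᵗ. -/
open Matrix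

section

variable {ι : Type*} [Fintype ι] [DecidableEq ι]

/-- For `Δ = diag(1,…,1,n,1,…,1)`, the `k`-th column of `B` is divisible by `n` off the diagonal
if and only if the conjugate `Δ B Δ⁻¹` is an integer matrix, necessarily of the same
determinant. -/
theorem forall_dvd_iff_exists_diagonal_mul_eq (k : ι) {n : ℤ} (hn : n ≠ 0) {d : ι → ℤ}
    (hk : d k = n) (hd : ∀ i, i ≠ k → d i = 1) {B : Matrix ι ι ℤ} (hB : B.det = 1) :
    (∀ i, i ≠ k → n ∣ B i k) ↔
      ∃ M : Matrix ι ι ℤ, M.det = 1 ∧ diagonal d * B = M * diagonal d := by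
  constructor
  · intro h
    have h' : ∀ i j, d j ∣ d i * B i j := by
      intro i j
      by_cases hj : j = k
      · subst hj
        by_cases hi : i = j
        · subst hi
          exact dvd_mul_right _ _
        · rw [hk]
          exact (h i hi).mul_left _
      · rw [hd j hj]
        exact one_dvd _
    choose M hM using h'
    have hmul : diagonal d * B = of M * diagonal d := by
      ext i j
      rw [diagonal_mul, mul_diagonal, hM, of_apply, mul_comm]
    refine ⟨of M, ?_, hmul⟩
    have hd0 : (diagonal d).det ≠ 0 := by
      rw [det_diagonal, Finset.prod_ne_zero_iff]
      intro i _
      by_cases hi : i = k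
      · rw [hi, hk]
        exact hn
      · rw [hd i hi]
        exact one_ne_zero
    have hdet := congrArg det hmul
    rw [det_mul, det_mul, hB, mul_one] at hdet
    exact mul_right_cancel₀ hd0 (by rw [one_mul, ← hdet])
  · rintro ⟨M, -, hM⟩ i hi
    have h := congrFun (congrFun hM i) k
    rw [diagonal_mul, mul_diagonal, hd i hi, one_mul, hk] at h
    exact h ▸ dvd_mul_left _ _

theorem det_nonsing_inv_eq_one {B : Matrix ι ι ℤ} (hB : B.det = 1) : B⁻¹.det = 1 := by
  rw [det_nonsing_inv, hB, Ring.inverse_one]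

/-- An integer matrix `Bt` of determinant one with `Bᵀ D Bt = D` exists if and only if
`D B = M D` for some integer matrix `M` of determinant one. -/
theorem exists_transpose_mul_diagonal_mul_eq_iff (d : ι → ℤ) (B : Matrix ι ι ℤ) :
    (∃ Bt : Matrix ι ι ℤ, Bt.det = 1 ∧ Bᵀ * diagonal d * Bt = diagonal d) ↔
      ∃ M : Matrix ι ι ℤ, M.det = 1 ∧ diagonal d * B = M * diagonal d := by
  constructor
  · rintro ⟨T, hT, h⟩
    refine ⟨Tᵀ⁻¹, det_nonsing_inv_eq_one (by rw [det_transpose, hT]), ?_⟩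
    have h' := congrArg transpose h
    rw [transpose_mul, transpose_mul, transpose_transpose, diagonal_transpose] at h'
    have hu : IsUnit Tᵀ.det := by rw [det_transpose, hT]; exact isUnit_one
    calc diagonal d * B = Tᵀ⁻¹ * (Tᵀ * (diagonal d * B)) :=
          (nonsing_inv_mul_cancel_left _ _ hu).symm
      _ = Tᵀ⁻¹ * diagonal d := by rw [h']
  · rintro ⟨M, hM, h⟩
    refine ⟨Mᵀ⁻¹, det_nonsing_inv_eq_one (by rw [det_transpose, hM]), ?_⟩
    have h' := congrArg transpose h
    rw [transpose_mul, transpose_mul, diagonal_transpose] at h'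
    have hu : IsUnit Mᵀ.det := by rw [det_transpose, hM]; exact isUnit_one
    rw [h', mul_nonsing_inv_cancel_right _ _ hu]

theorem exists_mul_eq_mul_nonsing_inv {D B : Matrix ι ι ℤ} (hB : B.det = 1)
    (h : ∃ M : Matrix ι ι ℤ, M.det = 1 ∧ D * B = M * D) :
    ∃ M : Matrix ι ι ℤ, M.det = 1 ∧ D * B⁻¹ = M * D := by
  obtain ⟨M, hM, h⟩ := h
  refine ⟨M⁻¹, det_nonsing_inv_eq_one hM, ?_⟩
  have hBu : IsUnit B.det := by rw [hB]; exact isUnit_one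
  have hMu : IsUnit M.det := by rw [hM]; exact isUnit_one
  calc D * B⁻¹ = M⁻¹ * (M * D) * B⁻¹ := by rw [nonsing_inv_mul_cancel_left _ _ hMu]
    _ = M⁻¹ * D := by rw [← h, ← mul_assoc, mul_nonsing_inv_cancel_right _ _ hBu]

theorem map_intCast_nonsing_inv {B : Matrix ι ι ℤ} (hB : B.det = 1) :
    (B⁻¹).map (Int.cast : ℤ → ℂ) = (B.map (Int.cast : ℤ → ℂ))⁻¹ := by
  have hBu : IsUnit B.det := by rw [hB]; exact isUnit_one
  refine (inv_eq_left_inv ?_).symm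
  calc (B⁻¹).map (Int.cast : ℤ → ℂ) * B.map (Int.cast : ℤ → ℂ)
      = (B⁻¹ * B).map (Int.cast : ℤ → ℂ) := (Matrix.map_mul (f := Int.castRingHom ℂ)).symm
    _ = 1 := by rw [nonsing_inv_mul B hBu, Matrix.map_one _ Int.cast_zero Int.cast_one]

/-- The congruence transformation of `τ A⁻¹ C⁻¹ (Aᵀ)⁻¹` when `A` is replaced by `A B⁻¹`. -/
theorem smul_inv_mul_inv_mul_inv_transpose (τ : ℂ) (C A : Matrix ι ι ℂ) {B : Matrix ι ι ℂ}
    (hB : IsUnit B.det) :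
    τ • ((A * B⁻¹)⁻¹ * C⁻¹ * ((A * B⁻¹)ᵀ)⁻¹) = B * (τ • (A⁻¹ * C⁻¹ * (Aᵀ)⁻¹)) * Bᵀ := by
  have hBt : IsUnit Bᵀ.det := by rwa [det_transpose]
  rw [transpose_mul, transpose_nonsing_inv, Matrix.mul_inv_rev, Matrix.mul_inv_rev,
    nonsing_inv_nonsing_inv _ hB, nonsing_inv_nonsing_inv _ hBt]
  simp only [Matrix.mul_assoc, Matrix.mul_smul, Matrix.smul_mul]

end

/-- Characterization of the group `Γ_n`: for `B ∈ SL(l,ℤ)` and `Δ = diag(1,…,1,n)` there is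
`B̃ ∈ SL(l,ℤ)` with `BᵗΔB̃ = Δ` iff `n ∣ B_{i,l}` for all `i < l`; the set `Γ_n` of such `B`
is a subgroup of `SL(l,ℤ)`; and period matrices `Ω = τA⁻¹C⁻¹(Aᵗ)⁻¹` with `A₂ = A₁B⁻¹`,
`B ∈ Γ_n`, are related by `Ω₂ = BΩ₁Bᵗ`. -/
theorem statement_19 (l : ℕ) (hl : 2 ≤ l) (n : ℕ) (hn : 1 ≤ n) :
    (∀ B : Matrix (Fin l) (Fin l) ℤ, B.det = 1 →
      ((∃ Bt : Matrix (Fin l) (Fin l) ℤ, Bt.det = 1 ∧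
          Bᵀ * Matrix.diagonal (fun i : Fin l => if (i : ℕ) = l - 1 then (n : ℤ) else 1) * Bt
            = Matrix.diagonal (fun i : Fin l => if (i : ℕ) = l - 1 then (n : ℤ) else 1)) ↔
        (∀ i : Fin l, (i : ℕ) < l - 1 → (n : ℤ) ∣ B i ⟨l - 1, by omega⟩))) ∧
    ((1 : Matrix (Fin l) (Fin l) ℤ) ∈
        {B : Matrix (Fin l) (Fin l) ℤ | B.det = 1 ∧
          ∀ i : Fin l, (i : ℕ) < l - 1 → (n : ℤ) ∣ B i ⟨l - 1, by omega⟩} ∧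
      (∀ B₁ ∈ {B : Matrix (Fin l) (Fin l) ℤ | B.det = 1 ∧
          ∀ i : Fin l, (i : ℕ) < l - 1 → (n : ℤ) ∣ B i ⟨l - 1, by omega⟩},
        ∀ B₂ ∈ {B : Matrix (Fin l) (Fin l) ℤ | B.det = 1 ∧
          ∀ i : Fin l, (i : ℕ) < l - 1 → (n : ℤ) ∣ B i ⟨l - 1, by omega⟩},
        B₁ * B₂ ∈ {B : Matrix (Fin l) (Fin l) ℤ | B.det = 1 ∧
          ∀ i : Fin l, (i : ℕ) < l - 1 → (n : ℤ) ∣ B i ⟨l - 1, by omega⟩}) ∧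
      (∀ B ∈ {B : Matrix (Fin l) (Fin l) ℤ | B.det = 1 ∧
          ∀ i : Fin l, (i : ℕ) < l - 1 → (n : ℤ) ∣ B i ⟨l - 1, by omega⟩},
        B⁻¹ ∈ {B : Matrix (Fin l) (Fin l) ℤ | B.det = 1 ∧
          ∀ i : Fin l, (i : ℕ) < l - 1 → (n : ℤ) ∣ B i ⟨l - 1, by omega⟩})) ∧
    (∀ (τ : ℂ) (C A₁ B : Matrix (Fin l) (Fin l) ℤ), Cᵀ = C →
      (C.map (Int.cast : ℤ → ℂ)).det ≠ 0 → A₁.det = 1 → B.det = 1 →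
      (∀ i : Fin l, (i : ℕ) < l - 1 → (n : ℤ) ∣ B i ⟨l - 1, by omega⟩) →
      τ • (((A₁ * B⁻¹).map (Int.cast : ℤ → ℂ))⁻¹ * (C.map (Int.cast : ℤ → ℂ))⁻¹ *
          (((A₁ * B⁻¹).map (Int.cast : ℤ → ℂ))ᵀ)⁻¹) =
        (B.map (Int.cast : ℤ → ℂ)) *
          (τ • ((A₁.map (Int.cast : ℤ → ℂ))⁻¹ * (C.map (Int.cast : ℤ → ℂ))⁻¹ *
            ((A₁.map (Int.cast : ℤ → ℂ))ᵀ)⁻¹)) *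
          (B.map (Int.cast : ℤ → ℂ))ᵀ) := by
  set d : Fin l → ℤ := fun i => if (i : ℕ) = l - 1 then (n : ℤ) else 1 with hd_def
  set k : Fin l := ⟨l - 1, by omega⟩ with hk_def
  have hlt : ∀ i : Fin l, (i : ℕ) < l - 1 ↔ i ≠ k := by
    intro i
    rw [hk_def, ne_eq, Fin.ext_iff]
    have := i.isLt
    dsimp only
    omega
  have hdk : d k = n := if_pos rfl
  have hd : ∀ i, i ≠ k → d i = 1 := fun i hi => if_neg ((hlt i).2 hi).ne
  have hn0 : (n : ℤ) ≠ 0 := by exact_mod_cast (by omega : n ≠ 0)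
  simp only [hlt, Set.mem_ofPred_eq]
  have key := fun {B : Matrix (Fin l) (Fin l) ℤ} (hB : B.det = 1) =>
    forall_dvd_iff_exists_diagonal_mul_eq k hn0 hdk hd hB
  refine ⟨fun B hB => ?_, ⟨⟨det_one, fun i hi => ?_⟩, ?_, ?_⟩, ?_⟩
  · rw [key hB]
    exact exists_transpose_mul_diagonal_mul_eq_iff d B
  · rw [one_apply_ne hi]
    exact dvd_zero _
  · rintro B₁ ⟨h₁, h₁'⟩ B₂ ⟨h₂, h₂'⟩
    refine ⟨by rw [det_mul, h₁, h₂, one_mul], fun i hi => ?_⟩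
    rw [mul_apply]
    refine Finset.dvd_sum fun j _ => ?_
    by_cases hj : j = k
    · rw [hj]
      exact (h₁' i hi).mul_right _
    · exact (h₂' j hj).mul_left _
  · rintro B ⟨hB, hB'⟩
    have hBi := det_nonsing_inv_eq_one hB
    exact ⟨hBi, (key hBi).2 (exists_mul_eq_mul_nonsing_inv hB ((key hB).1 hB'))⟩
  · intro τ C A B _ _ _ hB _
    have hBu : IsUnit (B.map (Int.cast : ℤ → ℂ)).det := by
      have h := (Int.castRingHom ℂ).map_det B
      rw [hB, map_one] at h
      exact h ▸ isUnit_one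
    have hmap : (A * B⁻¹).map (Int.cast : ℤ → ℂ) =
        A.map (Int.cast : ℤ → ℂ) * (B.map (Int.cast : ℤ → ℂ))⁻¹ := by
      rw [← map_intCast_nonsing_inv hB]
      exact Matrix.map_mul (f := Int.castRingHom ℂ)
    rw [hmap]
    exact smul_inv_mul_inv_mul_inv_transpose τ _ _ hBu
end
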